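/- arXiv:1109.5628 — 3 statements merged into one kernel-verified Lean document; each statement's English description precedes it below -/
import Mathlib

section
/- Let (R,m) be a Noetherian local ring, I an m-primary ideal of R, M a finitely generated R-module, and h ∈ I an element such that the torsion submodule (0 :_M h) has finite length. Then: (a) if dim_R M > 0, then h is a parameter for M, i.e. dim_R(M/hM) < dim_R M; (b) λ(0 :_M h) ≤ λ(H^0_m(M/hM)); (c) if dim_R M > 1 and M/hM is a Cohen–Macaulay R-module, then M is a Cohen–Macaulay R-module. -/
open IsLocalRing

section Defs

variable (R : Type) [CommRing R]

/-- The length of a module, as the Krull dimension of its lattice of submodules. -/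
noncomputable def mLength (M : Type) [AddCommGroup M] [Module R M] : WithBot ℕ∞ :=
  Order.krullDim (Submodule R M)

/-- The (Krull) dimension of a module. -/
noncomputable def mDim (M : Type) [AddCommGroup M] [Module R M] : WithBot ℕ∞ :=
  ringKrullDim (R ⧸ Submodule.annihilator (⊤ : Submodule R M))

/-- `f` is eventually given by the Hilbert-type polynomial of degree `t` with
coefficients `s 0, …, s t` (written in the binomial basis with alternating signs). -/
def IsHilbPolyAt (f : ℕ → WithBot ℕ∞) (t : ℕ) (s : ℕ → ℤ) : Prop :=
  ∃ N : ℕ, ∀ n ≥ N, ∃ l : ℕ, f n = (l : ℕ∞) ∧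
    (l : ℤ) = ∑ i ∈ Finset.range (t + 1), (-1 : ℤ) ^ i * s i * ((n + t - i).choose (t - i) : ℤ)

/-- `s 0, …, s t` are the Hilbert coefficients `e_i(I, M)`, i.e.
`λ(M/I^{n+1}M) = ∑ (-1)^i e_i(I,M) C(n+t-i, t-i)` for `n ≫ 0`. -/
def HasHilbCoeffs (I : Ideal R) (M : Type) [AddCommGroup M] [Module R M]
    (t : ℕ) (s : ℕ → ℤ) : Prop :=
  IsHilbPolyAt (fun n => mLength R (M ⧸ (I ^ (n + 1) • (⊤ : Submodule R M)))) t s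

/-- The unmixed component `U_M(0)` of `M`: the largest submodule of dimension `< dim M`. -/
noncomputable def unmixedComp (M : Type) [AddCommGroup M] [Module R M] : Submodule R M :=
  sSup {N : Submodule R M | mDim R ↥N < mDim R M}

/-- `x` is a d-sequence on `M`. -/
def IsDSeq {r : ℕ} (x : Fin r → R) (M : Type) [AddCommGroup M] [Module R M] : Prop :=
  ∀ i j : Fin r, i ≤ j →
    Submodule.comap (LinearMap.lsmul R M (x i * x j))
        (Ideal.span (x '' {k | k < i}) • (⊤ : Submodule R M))
      = Submodule.comap (LinearMap.lsmul R M (x j))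
        (Ideal.span (x '' {k | k < i}) • (⊤ : Submodule R M))

/-- `x` is a standard (d⁺-) system: all power sequences in any order are d-sequences. -/
def IsStandardSeq {r : ℕ} (x : Fin r → R) (M : Type) [AddCommGroup M] [Module R M] : Prop :=
  ∀ n : Fin r → ℕ, (∀ k, 1 ≤ n k) → ∀ σ : Equiv.Perm (Fin r),
    IsDSeq R (fun k => x (σ k) ^ n (σ k)) M

/-- The integral closure of an ideal, as a set. -/
def intClos (Q : Ideal R) : Set R :=
  {x : R | ∃ n : ℕ, 0 < n ∧ ∃ a : ℕ → R, (∀ i, 1 ≤ i → i ≤ n → a i ∈ Q ^ i) ∧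
    x ^ n + ∑ i ∈ Finset.Icc 1 n, a i * x ^ (n - i) = 0}

variable [IsLocalRing R]

/-- `h ∈ I` is superficial for `M` with respect to `I`. -/
def IsSuperficial (I : Ideal R) (M : Type) [AddCommGroup M] [Module R M] (h : R) : Prop :=
  h ∈ I ∧ ∃ c N : ℕ, ∀ n ≥ N,
    Submodule.comap (LinearMap.lsmul R M h) (I ^ (n + 1) • (⊤ : Submodule R M))
        ⊓ (I ^ c • (⊤ : Submodule R M))
      = I ^ n • (⊤ : Submodule R M)

/-- `Q` is a parameter ideal for `M` (`r` the dimension of `M`):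
generated by `r` elements of the maximal ideal with `M/QM` of finite length. -/
def IsParamIdeal (Q : Ideal R) (M : Type) [AddCommGroup M] [Module R M] (r : ℕ) : Prop :=
  Q ≤ maximalIdeal R ∧ (∃ x : Fin r → R, Q = Ideal.span (Set.range x)) ∧
    IsFiniteLength R (M ⧸ Q • (⊤ : Submodule R M))

/-- Local cohomology `H^i_𝔪(M)` with support in the maximal ideal. -/
noncomputable def LC (i : ℕ) (M : Type) [AddCommGroup M] [Module R M] : ModuleCat R :=
  (localCohomology (maximalIdeal R) i).obj (ModuleCat.of R M)

/-- `M` is Cohen–Macaulay: there is a regular sequence on `M` in the maximal ideal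
whose length equals `dim M`. -/
def IsCM (M : Type) [AddCommGroup M] [Module R M] : Prop :=
  ∃ rs : List R, (∀ x ∈ rs, x ∈ maximalIdeal R) ∧ RingTheory.Sequence.IsRegular M rs ∧
    (rs.length : WithBot ℕ∞) = mDim R M

/-- `M` is unmixed: `dim R̂/p = dim M` for every associated prime `p` of the completion `M̂`. -/
def IsUnmixed (M : Type) [AddCommGroup M] [Module R M] : Prop :=
  ∀ p ∈ associatedPrimes (AdicCompletion (maximalIdeal R) R)
      (AdicCompletion (maximalIdeal R) M),
    ringKrullDim ((AdicCompletion (maximalIdeal R) R) ⧸ p) = mDim R M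

/-- `M` is generalized Cohen–Macaulay: `H^i_𝔪(M)` has finite length for `i < r = dim M`. -/
def IsGenCM (M : Type) [AddCommGroup M] [Module R M] (r : ℕ) : Prop :=
  ∀ i < r, IsFiniteLength R ↥(LC R i M)

/-- The set `Λ(M)` of first Hilbert coefficients of parameter ideals for `M`. -/
def Lambda (M : Type) [AddCommGroup M] [Module R M] (r : ℕ) : Set ℤ :=
  {a : ℤ | ∃ (Q : Ideal R) (e : ℕ → ℤ),
    IsParamIdeal R Q M r ∧ HasHilbCoeffs R Q M r e ∧ e 1 = a}

/-- A standard parameter ideal: one generated by a standard system of parameters. -/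
def IsStandardParamIdeal (Q : Ideal R) (M : Type) [AddCommGroup M] [Module R M]
    (r : ℕ) : Prop :=
  IsParamIdeal R Q M r ∧ ∃ x : Fin r → R, Q = Ideal.span (Set.range x) ∧
    IsStandardSeq R x M

/-- `M` is Buchsbaum: every parameter ideal for `M` is standard. -/
def IsBuchsbaum (M : Type) [AddCommGroup M] [Module R M] (r : ℕ) : Prop :=
  ∀ Q : Ideal R, IsParamIdeal R Q M r → IsStandardParamIdeal R Q M r

/-- `M` is a Vasconcelos module. -/
def IsVasconcelos (M : Type) [AddCommGroup M] [Module R M] : Prop :=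
  mDim R M ≤ 0 ∨ (0 < mDim R M ∧ ∃ (r : ℕ) (Q : Ideal R) (e : ℕ → ℤ),
    mDim R M = (r : ℕ∞) ∧ IsParamIdeal R Q M r ∧ HasHilbCoeffs R Q M r e ∧ e 1 = 0)

/-- A Gorenstein local ring: Noetherian, Cohen–Macaulay, with an irreducible parameter ideal. -/
def IsGorensteinLocalRing : Prop :=
  IsNoetherianRing R ∧ IsCM R R ∧ ∃ (r : ℕ) (Q : Ideal R),
    mDim R R = (r : ℕ∞) ∧ IsParamIdeal R Q R r ∧
    ∀ I J : Ideal R, Q = I ⊓ J → Q = I ∨ Q = J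

/-- `E` is an injective envelope of the residue field `R/𝔪`. -/
def IsInjEnvResidue (E : Type) [AddCommGroup E] [Module R E] : Prop :=
  Module.Injective R E ∧ ∃ ι : (R ⧸ maximalIdeal R) →ₗ[R] E, Function.Injective ι ∧
    ∀ N : Submodule R E, N ⊓ LinearMap.range ι = ⊥ → N = ⊥

end Defs

/-- A (not necessarily local) Cohen–Macaulay ring: Noetherian,
with all localizations at primes Cohen–Macaulay. -/
def IsCMRing (S : Type) [CommRing S] : Prop :=
  IsNoetherianRing S ∧ ∀ (p : Ideal S) [p.IsPrime],
    IsCM (Localization.AtPrime p) (Localization.AtPrime p)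

/-- A (not necessarily local) Gorenstein ring. -/
def IsGorensteinRing (S : Type) [CommRing S] : Prop :=
  IsNoetherianRing S ∧ ∀ (p : Ideal S) [p.IsPrime],
    IsGorensteinLocalRing (Localization.AtPrime p)

/-- `HDegRel R I E M v` : `v` is the homological degree `hdeg_I(M)` computed
with Matlis duals taken relative to `E`. -/
inductive HDegRel (R : Type) [CommRing R] [IsLocalRing R] (I : Ideal R)
    (E : Type) [AddCommGroup E] [Module R E] : ModuleCat R → ℕ → Prop where
  | base : ∀ (M : ModuleCat R) (l : ℕ), mDim R M ≤ 0 → mLength R M = (l : ℕ∞) →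
      HDegRel R I E M l
  | step : ∀ (M : ModuleCat R) (r : ℕ), mDim R M = (r : ℕ∞) → 0 < r →
      ∀ (e : ℕ → ℤ) (e0 : ℕ), HasHilbCoeffs R I M r e → e 0 = (e0 : ℤ) →
      ∀ v : ℕ → ℕ,
        (∀ j < r, HDegRel R I E (ModuleCat.of R ((LC R j M) →ₗ[R] E)) (v j)) →
      HDegRel R I E M (e0 + ∑ j ∈ Finset.range r, (r - 1).choose j * v j)

theorem IsArtinian.exists_maximalIdeal_pow_smul_eq_zero {R : Type*} [CommRing R] [IsLocalRing R]
    (W : Type*) [AddCommGroup W] [Module R W] [IsNoetherian R W] [IsArtinian R W] :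
    ∃ t : ℕ, maximalIdeal R ^ t • (⊤ : Submodule R W) = ⊥ := by
  obtain ⟨t, ht⟩ := IsArtinian.monotone_stabilizes (R := R) (M := W)
    ⟨fun n => OrderDual.toDual (maximalIdeal R ^ n • (⊤ : Submodule R W)),
      fun a b hab => Submodule.smul_mono_left (Ideal.pow_le_pow_right hab)⟩
  refine ⟨t, Submodule.eq_bot_of_le_smul_of_le_jacobson_bot (maximalIdeal R) _
    (IsNoetherian.noetherian _) ?_ (maximalIdeal_le_jacobson _)⟩
  have := ht (t + 1) (Nat.le_succ t)
  change maximalIdeal R ^ t • (⊤ : Submodule R W) = maximalIdeal R ^ (t + 1) • ⊤ at this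
  rw [← Submodule.mul_smul, ← pow_succ', ← this]

theorem LinearMap.isArtinian_ker_comp {R M N P : Type*} [Ring R] [AddCommGroup M] [AddCommGroup N]
    [AddCommGroup P] [Module R M] [Module R N] [Module R P] (f : M →ₗ[R] N) (g : N →ₗ[R] P)
    [IsArtinian R (ker f)] [IsArtinian R (ker g)] : IsArtinian R (ker (g ∘ₗ f)) := by
  refine isArtinian_of_range_eq_ker
    (Submodule.inclusion (ker_le_ker_comp f g) : ker f →ₗ[R] ker (g ∘ₗ f))
    (f.restrict (p := ker (g ∘ₗ f)) (q := ker g) fun x hx => hx) ?_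
  ext x
  simp only [Submodule.range_inclusion, Submodule.mem_comap, Submodule.subtype_apply,
    LinearMap.mem_ker, Subtype.ext_iff, ZeroMemClass.coe_zero]
  rfl

theorem LinearMap.length_ker_eq_length_coker {R W : Type*} [Ring R] [AddCommGroup W] [Module R W]
    [IsNoetherian R W] [IsArtinian R W] (f : W →ₗ[R] W) :
    Module.length R (ker f) = Module.length R (W ⧸ range f) := by
  have h₁ := Module.length_eq_add_of_exact (ker f).subtype f.rangeRestrict
    (ker f).injective_subtype f.surjective_rangeRestrict
    (by rw [LinearMap.exact_iff]; simp)
  have h₂ := Module.length_eq_add_of_exact (range f).subtype (range f).mkQ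
    (range f).injective_subtype (range f).mkQ_surjective
    (by rw [LinearMap.exact_iff]; simp)
  rw [h₁, add_comm] at h₂
  exact WithTop.add_left_cancel Module.length_ne_top h₂

theorem exists_length_ker_lsmul_le_length_torsionBySet {R M : Type*} [CommRing R] [IsLocalRing R]
    [AddCommGroup M] [Module R M] [IsNoetherian R M] (h : R)
    [IsArtinian R (LinearMap.ker (LinearMap.lsmul R M h))] :
    ∃ t : ℕ, Module.length R (LinearMap.ker (LinearMap.lsmul R M h)) ≤
      Module.length R (Submodule.torsionBySet R (M ⧸ Ideal.span {h} • (⊤ : Submodule R M))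
        ((maximalIdeal R ^ t : Ideal R) : Set R)) := by
  obtain ⟨k, hk⟩ := monotone_stabilizes_iff_noetherian.2 ‹IsNoetherian R M›
    (LinearMap.iterateKer (LinearMap.lsmul R M h))
  have key (n : ℕ) (x : M) : x ∈ LinearMap.ker (LinearMap.lsmul R M h ^ n) ↔ h ^ n • x = 0 := by
    rw [LinearMap.mem_ker, Module.End.pow_apply]
    change (fun y : M => h • y)^[n] x = 0 ↔ _
    rw [smul_iterate]
  have stab : LinearMap.ker (LinearMap.lsmul R M h ^ k) =
    LinearMap.ker (LinearMap.lsmul R M h ^ (k + 1)) := hk (k + 1) (Nat.le_succ k)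
  have art (n : ℕ) : IsArtinian R (LinearMap.ker (LinearMap.lsmul R M h ^ n)) := by
    induction n with
    | zero => rw [pow_zero, Module.End.one_eq_id, LinearMap.ker_id]; infer_instance
    | succ n ih => rw [pow_succ]; exact LinearMap.isArtinian_ker_comp _ _
  have := art k
  set W := LinearMap.ker (LinearMap.lsmul R M h ^ k)
  let f : W →ₗ[R] W := LinearMap.lsmul R W h
  let g : W →ₗ[R] M ⧸ Ideal.span {h} • (⊤ : Submodule R M) := (Submodule.mkQ _).comp W.subtype
  have hsub : LinearMap.ker (LinearMap.lsmul R M h) ≤ W := by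
    intro x hx
    rw [stab, key, pow_succ, mul_smul, show h • x = 0 from hx, smul_zero]
  have e₁ : Module.length R (LinearMap.ker (LinearMap.lsmul R M h)) ≤
      Module.length R (LinearMap.ker f) :=
    Module.length_le_of_injective
      (LinearMap.codRestrict (LinearMap.ker f) (Submodule.inclusion hsub)
        fun x => Subtype.ext x.2)
      (fun x y hxy => Subtype.ext (congrArg (fun z : LinearMap.ker f => ((z : W) : M)) hxy))
  have hfg : LinearMap.range f = LinearMap.ker g := by
    ext x
    simp only [LinearMap.mem_range, LinearMap.mem_ker, g, f, LinearMap.comp_apply,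
      Submodule.mkQ_apply, Submodule.Quotient.mk_eq_zero, Submodule.ideal_span_singleton_smul,
      Submodule.mem_smul_pointwise_iff_exists, LinearMap.lsmul_apply]
    constructor
    · rintro ⟨y, rfl⟩
      exact ⟨y, trivial, rfl⟩
    · rintro ⟨y, -, hy⟩
      refine ⟨⟨y, ?_⟩, Subtype.ext hy⟩
      rw [stab, key, pow_succ, mul_smul, hy]
      exact (key _ _).1 x.2
  obtain ⟨t, ht⟩ := IsArtinian.exists_maximalIdeal_pow_smul_eq_zero (R := R) W
  refine ⟨t, e₁.trans ?_⟩
  rw [LinearMap.length_ker_eq_length_coker, hfg, g.quotKerEquivRange.length_eq]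
  have hle : LinearMap.range g ≤ Submodule.torsionBySet R
      (M ⧸ Ideal.span {h} • (⊤ : Submodule R M)) ((maximalIdeal R ^ t : Ideal R) : Set R) := by
    rintro _ ⟨x, rfl⟩
    rw [Submodule.mem_torsionBySet_iff]
    rintro ⟨a, ha⟩
    have : a • x = 0 := by
      rw [← Submodule.mem_bot R, ← ht]
      exact Submodule.smul_mem_smul ha trivial
    change a • g x = 0
    rw [← map_smul, this, map_zero]
  exact Module.length_le_of_injective (Submodule.inclusion hle) (Submodule.inclusion_injective hle)

section LocalCohomologyZero

open CategoryTheory Limits Opposite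

universe u

variable (R : Type u) [CommRing R] 

instance linearYoneda_obj_preservesLimits (Y : ModuleCat.{u} R) :
    PreservesLimits ((linearYoneda R (ModuleCat.{u} R)).obj Y) := by
  have : PreservesLimits ((linearYoneda R (ModuleCat.{u} R)).obj Y ⋙ forget (ModuleCat.{u} R)) :=
    inferInstanceAs (PreservesLimits (yoneda.obj Y))
  exact preservesLimits_of_reflects_of_preserves _ (forget (ModuleCat.{u} R))

instance linearYoneda_obj_rightOp_preservesFiniteColimits (Y : ModuleCat.{u} R) :
    PreservesFiniteColimits ((linearYoneda R (ModuleCat.{u} R)).obj Y).rightOp :=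
  preservesFiniteColimits_rightOp _


/-- `Ext⁰(-, Y)` is the functor of homomorphisms into `Y`. -/
noncomputable def extZeroIso (Y : ModuleCat.{u} R) :
    (Ext R (ModuleCat.{u} R) 0).flip.obj Y ≅ (linearYoneda R (ModuleCat.{u} R)).obj Y :=
  let e := ((linearYoneda R (ModuleCat.{u} R)).obj Y).rightOp.leftDerivedZeroIsoSelf
  { hom := NatTrans.leftOp e.inv
    inv := NatTrans.leftOp e.hom
    hom_inv_id := by
      ext1; ext1 X
      exact congrArg Quiver.Hom.unop (e.hom_inv_id_app X.unop)
    inv_hom_id := by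
      ext1; ext1 X
      exact congrArg Quiver.Hom.unop (e.inv_hom_id_app X.unop) }


/-- Evaluation at the class of `1`, as a map `Hom(R/J, N) ⟶ N`. -/
def quotientHomEvalOne (J : Ideal R) (N : ModuleCat.{u} R) :
    ((linearYoneda R (ModuleCat.{u} R)).obj N).obj (op (ModuleCat.of R (R ⧸ J))) ⟶ N :=
  ModuleCat.ofHom
    { toFun := fun φ : ModuleCat.of R (R ⧸ J) ⟶ N => φ.hom (1 : R ⧸ J)
      map_add' := fun _ _ => rfl
      map_smul' := fun _ _ => rfl }

/-- An element of `N` killed by `J` determines a homomorphism `R/J ⟶ N`. -/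
def torsionBySetToHomQuotient (J : Ideal R) (N : Type u) [AddCommGroup N] [Module R N] :
    Submodule.torsionBySet R N (J : Set R) →ₗ[R]
      (ModuleCat.of R (R ⧸ J) ⟶ ModuleCat.of R N) where
  toFun x := ModuleCat.ofHom (Submodule.liftQ J (LinearMap.toSpanSingleton R N x) fun a ha =>
    (Submodule.mem_torsionBySet_iff _ _).1 x.2 ⟨a, ha⟩)
  map_add' x y := ModuleCat.hom_ext
    (Submodule.linearMap_qext _ (LinearMap.ext fun r => smul_add r (x : N) y))
  map_smul' a x := ModuleCat.hom_ext
    (Submodule.linearMap_qext _ (LinearMap.ext fun r => smul_comm r a (x : N)))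

/-- The maps `Ext⁰(R/Jᵗ, N) ≅ Hom(R/Jᵗ, N) ⟶ N`, as a cocone on the system computing `H⁰_J(N)`. -/
noncomputable def extZeroEvalOneCocone (J : Ideal R) (N : ModuleCat.{u} R) :
    Cocone (localCohomology.diagram (localCohomology.idealPowersDiagram J) 0 ⋙
      (evaluation _ _).obj N) where
  pt := N
  ι :=
    { app := fun X => (extZeroIso R N).hom.app (op (ModuleCat.of R (R ⧸ J ^ X.unop.unop))) ≫
        quotientHomEvalOne R (J ^ X.unop.unop) N
      naturality := fun X Y f => by
        have := (extZeroIso R N).hom.naturality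
          ((localCohomology.ringModIdeals (localCohomology.idealPowersDiagram J)).map f.unop).op
        refine (congrArg (· ≫ quotientHomEvalOne R (J ^ Y.unop.unop) N) this).trans ?_
        rfl }

theorem length_torsionBySet_le_length_localCohomology_zero (J : Ideal R) (t : ℕ) (N : Type u)
    [AddCommGroup N] [Module R N] :
    Module.length R (Submodule.torsionBySet R N ((J ^ t : Ideal R) : Set R)) ≤
      Module.length R ((localCohomology J 0).obj (ModuleCat.of R N)) := by
  let D := localCohomology.diagram (localCohomology.idealPowersDiagram J) 0
  let c := extZeroEvalOneCocone R J (ModuleCat.of R N)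
  let e := (extZeroIso R (ModuleCat.of R N)).app (op (ModuleCat.of R (R ⧸ J ^ t)))
  let i : (D.obj (op (op t))).obj (ModuleCat.of R N) ⟶
      (localCohomology J 0).obj (ModuleCat.of R N) := (colimit.ι D (op (op t))).app _
  have hc := isColimitOfPreserves ((evaluation _ _).obj (ModuleCat.of R N)) (colimit.isColimit D)
  have fac : e.inv ≫ i ≫ hc.desc c = quotientHomEvalOne R (J ^ t) (ModuleCat.of R N) :=
    (Iso.inv_comp_eq _).2 (hc.fac c (op (op t)))
  let s := torsionBySetToHomQuotient R (J ^ t) N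
  have hs (x) : (quotientHomEvalOne R (J ^ t) (ModuleCat.of R N)).hom (s x) = x := by
    exact one_smul R (x : N)
  refine Module.length_le_of_injective (i.hom ∘ₗ e.inv.hom ∘ₗ s) fun x y hxy => Subtype.ext ?_
  rw [← hs x, ← hs y, ← fac]
  exact congrArg (hc.desc c).hom hxy

end LocalCohomologyZero

theorem mDim_eq_supportDim (R : Type) [CommRing R] (M : Type) [AddCommGroup M] [Module R M]
    [Module.Finite R M] : mDim R M = Module.supportDim R M := by
  rw [Module.supportDim_eq_ringKrullDim_quotient_annihilator, mDim, Submodule.annihilator_top]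

theorem notMem_minimalPrimes_annihilator_of_isArtinian_ker_lsmul {R M : Type*} [CommRing R]
    [IsLocalRing R] [IsNoetherianRing R] [AddCommGroup M] [Module R M] [Module.Finite R M] (h : R)
    [IsArtinian R (LinearMap.ker (LinearMap.lsmul R M h))] (hdim : 0 < Module.supportDim R M)
    (p : Ideal R) (hp : p ∈ (Module.annihilator R M).minimalPrimes) : h ∉ p := by
  intro hhp
  have hprime : p.IsPrime := hp.1.1
  obtain ⟨f, hf⟩ := (isAssociatedPrime_iff_exists_injective_linearMap p M).1
    (Module.associatedPrimes.minimalPrimes_annihilator_subset_associatedPrimes R M hp) |>.2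
  have hker (x : R ⧸ p) : f x ∈ LinearMap.ker (LinearMap.lsmul R M h) := by
    obtain ⟨r, rfl⟩ := Ideal.Quotient.mk_surjective x
    rw [LinearMap.mem_ker, LinearMap.lsmul_apply, ← map_smul, Algebra.smul_def,
      Ideal.Quotient.algebraMap_eq, Ideal.Quotient.eq_zero_iff_mem.2 hhp, zero_mul, map_zero]
  have : IsArtinian R (R ⧸ p) := isArtinian_of_injective
    (f.codRestrict _ hker) (fun x y hxy => hf (congrArg Subtype.val hxy))
  have : IsArtinianRing (R ⧸ p) := isArtinian_of_tower R this
  have hpm : p = maximalIdeal R := eq_maximalIdeal (Ideal.Quotient.maximal_of_isField p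
    (IsArtinianRing.isField_of_isDomain _))
  have : Subsingleton (Module.support R M) := by
    have key (q : Module.support R M) : q.1.asIdeal = maximalIdeal R := by
      refine le_antisymm (le_maximalIdeal q.1.2.ne_top) ?_
      rw [← hpm]
      exact hp.2 ⟨q.1.2, Module.annihilator_le_of_mem_support q.2⟩
        (hpm ▸ le_maximalIdeal q.1.2.ne_top)
    exact ⟨fun q q' => Subtype.ext (PrimeSpectrum.ext ((key q).trans (key q').symm))⟩
  exact hdim.not_ge (Order.krullDim_nonpos_of_subsingleton)

theorem IsSMulRegular.torsionBySet_pow_eq_bot {R M : Type*} [CommRing R] [AddCommGroup M]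
    [Module R M] {x : R} {J : Ideal R} (hx : x ∈ J) (hreg : IsSMulRegular M x) (t : ℕ) :
    Submodule.torsionBySet R M ((J ^ t : Ideal R) : Set R) = ⊥ := by
  refine (Submodule.eq_bot_iff _).2 fun m hm => ?_
  have : x ^ t • m = 0 := (Submodule.mem_torsionBySet_iff _ _).1 hm ⟨_, Ideal.pow_mem_pow hx t⟩
  exact (hreg.pow t) (by simpa using this)

theorem statement0 (R : Type) [CommRing R] [IsLocalRing R] [IsNoetherianRing R]
    (I : Ideal R) (hI : I.radical = maximalIdeal R)
    (M : Type) [AddCommGroup M] [Module R M] [Module.Finite R M]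
    (h : R) (hhI : h ∈ I)
    (hfin : IsFiniteLength R ↥(LinearMap.ker (LinearMap.lsmul R M h))) :
    ((0 : WithBot ℕ∞) < mDim R M →
      mDim R (M ⧸ Ideal.span {h} • (⊤ : Submodule R M)) < mDim R M) ∧
    (mLength R ↥(LinearMap.ker (LinearMap.lsmul R M h)) ≤
      mLength R ↥(LC R 0 (M ⧸ Ideal.span {h} • (⊤ : Submodule R M)))) ∧
    ((1 : WithBot ℕ∞) < mDim R M →
      IsCM R (M ⧸ Ideal.span {h} • (⊤ : Submodule R M)) → IsCM R M) := by
  have art : IsArtinian R (LinearMap.ker (LinearMap.lsmul R M h)) :=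
    (isFiniteLength_iff_isNoetherian_isArtinian.1 hfin).2
  have hm : h ∈ maximalIdeal R := hI ▸ Ideal.le_radical hhI
  let e : (M ⧸ Ideal.span {h} • (⊤ : Submodule R M)) ≃ₗ[R] QuotSMulTop h M :=
    Submodule.quotEquivOfEq _ _ (Submodule.ideal_span_singleton_smul h ⊤)
  obtain ⟨t, ht⟩ := exists_length_ker_lsmul_le_length_torsionBySet (M := M) h
  rw [mDim_eq_supportDim, mDim_eq_supportDim, Module.supportDim_eq_of_equiv e]
  have hsucc (hdim : 0 < Module.supportDim R M) :
      Module.supportDim R (QuotSMulTop h M) + 1 = Module.supportDim R M :=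
    Module.supportDim_quotSMulTop_succ_eq_of_notMem_minimalPrimes_of_mem_maximalIdeal
      (notMem_minimalPrimes_annihilator_of_isArtinian_ker_lsmul h hdim) hm
  refine ⟨fun hdim => ?_, ?_, fun hdim => ?_⟩
  · have hlt : Module.supportDim R M < ⊤ :=
      Module.supportDim_le_ringKrullDim R M |>.trans_lt ringKrullDim_lt_top
    have hs := hsucc hdim
    rw [← hs] at hlt hdim ⊢
    clear hs
    generalize Module.supportDim R (QuotSMulTop h M) = d at hlt hdim ⊢
    cases d with
    | bot => simp at hdim
    | coe d =>
      cases d with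
      | top => exact absurd hlt (by decide)
      | coe d => exact_mod_cast Nat.lt_succ_self d
  · rw [mLength, mLength, ← Module.coe_length, ← Module.coe_length, WithBot.coe_le_coe]
    exact ht.trans (length_torsionBySet_le_length_localCohomology_zero R (maximalIdeal R) t _)
  · rintro ⟨rs, hrs, hreg, hlen⟩
    rw [mDim_eq_supportDim, Module.supportDim_eq_of_equiv e] at hlen
    have hs := hsucc (zero_lt_one.trans hdim)
    rw [← hlen] at hs
    have hh : IsSMulRegular M h := by
      cases rs with
      | nil =>
        rw [← hs] at hdim
        simp at hdim
      | cons x rs =>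
        have hx : IsSMulRegular (M ⧸ Ideal.span {h} • (⊤ : Submodule R M)) x :=
          ((RingTheory.Sequence.isRegular_cons_iff _ x rs).1 hreg).1
        rw [hx.torsionBySet_pow_eq_bot (hrs x List.mem_cons_self), Module.length_bot,
          nonpos_iff_eq_zero, Module.length_eq_zero_iff, Submodule.subsingleton_iff_eq_bot] at ht
        exact LinearMap.ker_eq_bot.1 ht
    refine ⟨h :: rs, ?_, .cons hh ((e.isRegular_congr rs).1 hreg), ?_⟩
    · simpa using ⟨hm, hrs⟩
    · rw [mDim_eq_supportDim, ← hs]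
      simp
end

section
/- Let (R,m) be a Noetherian local ring, I an m-primary ideal, and M a finitely generated R-module with r = dim_R M > 0. (a) If h ∈ I is superficial for M with respect to I, then e_i(I,M) = e_i(I/(h), M/hM) for 0 ≤ i < r−1 and e_{r−1}(I,M) = e_{r−1}(I/(h), M/hM) + (−1)^r λ(0 :_M h). (b) If 0 → A → B → C → 0 is an exact sequence of finitely generated R-modules with t = dim_R A < s = dim_R B, then e_i(I,B) = e_i(I,C) for 0 ≤ i < s−t; in particular if t = 0 and s ≥ 2 then e_1(I,B) = e_1(I,C). (c) If dim_R M = 1 and I is a parameter ideal for M, then e_1(I,M) = −λ(H^0_m(M)). (d) If dim_R M = 2, I is a parameter ideal for M, and h ∈ I is superficial for M with respect to I, then e_1(I,M) = e_1(I/(h), M/hM) + λ(0 :_M h) = −λ(H^0_m(M/hM)) + λ(0 :_M h) = −λ((0) :_{H^1_m(M)} h). -/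
open IsLocalRing

namespace ExtClass

open CategoryTheory Limits Opposite

variable {R : Type} [CommRing R]

/-- The functor `Hom(-, Y)` with values in the opposite category. -/
noncomputable abbrev homOp (Y : ModuleCat.{0} R) : ModuleCat.{0} R ⥤ (ModuleCat.{0} R)ᵒᵖ :=
  ((linearYoneda R (ModuleCat.{0} R)).obj Y).rightOp

/-- The complex `Hom(P, Y)` with values in the opposite category. -/
noncomputable abbrev homComplex {X : ModuleCat.{0} R} (P : ProjectiveResolution X)
    (Y : ModuleCat.{0} R) : ChainComplex (ModuleCat.{0} R)ᵒᵖ ℕ :=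
  ((homOp Y).mapHomologicalComplex _).obj P.complex

/-- `Ext` in the opposite category as a homology object of `Hom(P, Y)`. -/
noncomputable def isoHomology {X : ModuleCat.{0} R} (P : ProjectiveResolution X)
    (Y : ModuleCat.{0} R) (n : ℕ) :
    ((homOp Y).leftDerived n).obj X ≅ (homComplex P Y).homology n :=
  P.isoLeftDerivedObj (homOp Y) n

lemma isoHomology_hom_naturality {X X' : ModuleCat.{0} R} (P : ProjectiveResolution X)
    (P' : ProjectiveResolution X') (f : X' ⟶ X) (τ : P'.complex ⟶ P.complex)
    (hτ : τ.f 0 ≫ P.π.f 0 = P'.π.f 0 ≫ f) (Y : ModuleCat.{0} R) (n : ℕ) :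
    ((homOp Y).leftDerived n).map f ≫ (isoHomology P Y n).hom =
      (isoHomology P' Y n).hom ≫ HomologicalComplex.homologyMap
        (((homOp Y).mapHomologicalComplex (ComplexShape.down ℕ)).map τ) n :=
  ProjectiveResolution.isoLeftDerivedObj_hom_naturality f P' P τ hτ (homOp Y) n

/-- The cocycles of `Hom(P, Y)` map onto `Ext`. -/
noncomputable def ofCocycles {X : ModuleCat.{0} R} (P : ProjectiveResolution X)
    (Y : ModuleCat.{0} R) (n : ℕ) :
    ((homComplex P Y).opcycles n).unop ⟶ ((Ext R (ModuleCat.{0} R) n).obj (op X)).obj Y :=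
  ((isoHomology P Y n).hom ≫ (homComplex P Y).homologyι n).unop

lemma ofCocycles_surjective {X : ModuleCat.{0} R} (P : ProjectiveResolution X)
    (Y : ModuleCat.{0} R) (n : ℕ) : Function.Surjective (ofCocycles P Y n) := by
  have : Epi (ofCocycles P Y n) := unop_epi_of_mono _
  exact (ModuleCat.epi_iff_surjective _).1 this

/-- A cocycle as a morphism. -/
noncomputable def cocycleHom {X : ModuleCat.{0} R} (P : ProjectiveResolution X)
    (Y : ModuleCat.{0} R) (n : ℕ) :
    ((homComplex P Y).opcycles n).unop ⟶ ModuleCat.of R (P.complex.X n ⟶ Y) :=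
  ((homComplex P Y).pOpcycles n).unop

lemma cocycleHom_injective {X : ModuleCat.{0} R} (P : ProjectiveResolution X)
    (Y : ModuleCat.{0} R) (n : ℕ) : Function.Injective (cocycleHom P Y n) := by
  have : Mono (cocycleHom P Y n) := unop_mono_of_epi _
  exact (ModuleCat.mono_iff_injective _).1 this

lemma exists_cocycle {X : ModuleCat.{0} R} (P : ProjectiveResolution X)
    (Y : ModuleCat.{0} R) (n : ℕ) (f : P.complex.X n ⟶ Y)
    (hf : P.complex.d (n + 1) n ≫ f = 0) : ∃ z, cocycleHom P Y n z = f := by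
  let k : (homComplex P Y).X n ⟶ op (ModuleCat.of R R) :=
    Quiver.Hom.op (ModuleCat.ofHom (LinearMap.toSpanSingleton R (P.complex.X n ⟶ Y) f))
  have hk : (homComplex P Y).d (n + 1) n ≫ k = 0 := by
    apply Quiver.Hom.unop_inj
    ext
    change P.complex.d (n + 1) n ≫ ((1 : R) • f) = 0
    rw [one_smul, hf]
  let d := (homComplex P Y).descOpcycles k (n + 1) (by simp) hk
  have hd : (homComplex P Y).pOpcycles n ≫ d = k := by simp [d]
  refine ⟨d.unop.hom (1 : R), ?_⟩
  have h2 := congrArg (fun t : (homComplex P Y).X n ⟶ op (ModuleCat.of R R) =>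
    t.unop.hom (1 : R)) hd
  refine h2.trans ?_
  exact one_smul R f

lemma d_comp_cocycleHom {X : ModuleCat.{0} R} (P : ProjectiveResolution X)
    (Y : ModuleCat.{0} R) (n : ℕ) (z) :
    P.complex.d (n + 1) n ≫ (show P.complex.X n ⟶ Y from cocycleHom P Y n z) = 0 := by
  have h := (homComplex P Y).d_pOpcycles (n + 1) n
  exact congrArg (fun t : (homComplex P Y).X (n + 1) ⟶ (homComplex P Y).opcycles n =>
    t.unop.hom z) h

lemma ofCocycles_eq_zero_iff {X : ModuleCat.{0} R} (P : ProjectiveResolution X)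
    (Y : ModuleCat.{0} R) (n j : ℕ) (hj : (ComplexShape.down ℕ).next n = j) (z) :
    ofCocycles P Y n z = 0 ↔
      ∃ g : P.complex.X j ⟶ Y, cocycleHom P Y n z = P.complex.d n j ≫ g := by
  let K := homComplex P Y
  let S : ShortComplex (ModuleCat.{0} R)ᵒᵖ :=
    ShortComplex.mk (K.homologyι n) (K.fromOpcycles n j) (by simp)
  have hS : S.Exact := S.exact_of_f_is_kernel (K.homologyIsKernel n j hj)
  have hU := (ShortComplex.moduleCat_exact_iff _).1 hS.unop
  have hfrom (g : P.complex.X j ⟶ Y) :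
      cocycleHom P Y n ((K.fromOpcycles n j).unop.hom g) = P.complex.d n j ≫ g := by
    have h := K.p_fromOpcycles n j
    exact congrArg (fun t : K.X n ⟶ K.X j => t.unop.hom g) h
  have hiso : ofCocycles P Y n z = 0 ↔ (K.homologyι n).unop z = 0 := by
    have hm : Mono (isoHomology P Y n).hom.unop := unop_mono_of_epi _
    have hi := (ModuleCat.mono_iff_injective _).1 hm
    exact map_eq_zero_iff (isoHomology P Y n).hom.unop.hom hi
  rw [hiso]
  constructor
  · intro h
    obtain ⟨g, hg⟩ := hU z h
    refine ⟨g, ?_⟩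
    rw [← hfrom g]
    exact congrArg _ hg.symm
  · rintro ⟨g, hg⟩
    rw [← hfrom g] at hg
    rw [cocycleHom_injective P Y n hg]
    exact congrArg (fun t : (ModuleCat.of R (P.complex.X j ⟶ Y)) ⟶ (K.homology n).unop => t.hom g)
      (congrArg Quiver.Hom.unop (K.homologyι_comp_fromOpcycles n j))

lemma map_ofCocycles {X X' : ModuleCat.{0} R} (P : ProjectiveResolution X)
    (P' : ProjectiveResolution X') (f : X' ⟶ X) (τ : P'.complex ⟶ P.complex)
    (hτ : τ.f 0 ≫ P.π.f 0 = P'.π.f 0 ≫ f)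
    (Y : ModuleCat.{0} R) (n : ℕ) (z z')
    (h : cocycleHom P' Y n z' = τ.f n ≫ (show P.complex.X n ⟶ Y from cocycleHom P Y n z)) :
    ((Ext R (ModuleCat.{0} R) n).map f.op).app Y (ofCocycles P Y n z) =
      ofCocycles P' Y n z' := by
  let α := ((homOp Y).mapHomologicalComplex (ComplexShape.down ℕ)).map τ
  have h1 := isoHomology_hom_naturality P P' f τ hτ Y n
  have h2 := HomologicalComplex.homologyι_naturality α n
  have h3 := HomologicalComplex.p_opcyclesMap α n
  have hz : z' = (HomologicalComplex.opcyclesMap α n).unop z := by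
    apply cocycleHom_injective
    rw [h]
    exact (congrArg (fun t : (homComplex P' Y).X n ⟶ (homComplex P Y).opcycles n =>
      t.unop.hom z) h3).symm
  rw [hz]
  have h4 : ((homOp Y).leftDerived n).map f ≫
      ((isoHomology P Y n).hom ≫ (homComplex P Y).homologyι n) =
      ((isoHomology P' Y n).hom ≫ (homComplex P' Y).homologyι n) ≫
        HomologicalComplex.opcyclesMap α n := by
    rw [← Category.assoc, h1, Category.assoc, Category.assoc, h2]
  exact congrArg (fun t : ((homOp Y).leftDerived n).obj X' ⟶ (homComplex P Y).opcycles n =>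
      t.unop.hom z) h4

section General

variable {X : ModuleCat.{0} R} (P : ProjectiveResolution X) (Y : ModuleCat.{0} R) (n : ℕ)

/-- The submodule of cocycles in `Hom(P_n, Y)`. -/
noncomputable def cocycles : Submodule R (P.complex.X n ⟶ Y) :=
  LinearMap.ker (Linear.leftComp R Y (P.complex.d (n + 1) n))

lemma mem_cocycles (f : P.complex.X n ⟶ Y) :
    f ∈ cocycles P Y n ↔ P.complex.d (n + 1) n ≫ f = 0 := Iff.rfl

lemma range_cocycleHom : LinearMap.range (cocycleHom P Y n).hom = cocycles P Y n := by
  ext f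
  constructor
  · rintro ⟨z, rfl⟩
    exact d_comp_cocycleHom P Y n z
  · exact exists_cocycle P Y n f

/-- The class in `Ext` of a cocycle. -/
noncomputable def cls : cocycles P Y n →ₗ[R] ((Ext R (ModuleCat.{0} R) n).obj (op X)).obj Y :=
  (ofCocycles P Y n).hom ∘ₗ
    ((LinearEquiv.ofInjective (cocycleHom P Y n).hom (cocycleHom_injective P Y n)).trans
      (LinearEquiv.ofEq _ _ (range_cocycleHom P Y n))).symm.toLinearMap

lemma exists_cls (f : cocycles P Y n) :
    ∃ z, cocycleHom P Y n z = f.1 ∧ cls P Y n f = ofCocycles P Y n z := by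
  refine ⟨((LinearEquiv.ofInjective (cocycleHom P Y n).hom (cocycleHom_injective P Y n)).trans
      (LinearEquiv.ofEq _ _ (range_cocycleHom P Y n))).symm f, ?_, rfl⟩
  exact congrArg Subtype.val (((LinearEquiv.ofInjective (cocycleHom P Y n).hom
    (cocycleHom_injective P Y n)).trans
      (LinearEquiv.ofEq _ _ (range_cocycleHom P Y n))).apply_symm_apply f)

lemma cls_surjective : Function.Surjective (cls P Y n) := by
  intro x
  obtain ⟨z, rfl⟩ := ofCocycles_surjective P Y n x
  refine ⟨⟨cocycleHom P Y n z, d_comp_cocycleHom P Y n z⟩, ?_⟩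
  obtain ⟨z', h1, h2⟩ := exists_cls P Y n ⟨cocycleHom P Y n z, d_comp_cocycleHom P Y n z⟩
  rw [h2, cocycleHom_injective P Y n h1]

lemma cls_eq_zero_iff (j : ℕ) (hj : (ComplexShape.down ℕ).next n = j) (f : cocycles P Y n) :
    cls P Y n f = 0 ↔ ∃ g : P.complex.X j ⟶ Y, f.1 = P.complex.d n j ≫ g := by
  obtain ⟨z, h1, h2⟩ := exists_cls P Y n f
  rw [h2, ofCocycles_eq_zero_iff P Y n j hj, h1]

lemma map_cls {X' : ModuleCat.{0} R}
    (P' : ProjectiveResolution X') (f : X' ⟶ X) (τ : P'.complex ⟶ P.complex)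
    (hτ : τ.f 0 ≫ P.π.f 0 = P'.π.f 0 ≫ f) (a : cocycles P Y n) (a' : cocycles P' Y n)
    (h : a'.1 = τ.f n ≫ a.1) :
    ((Ext R (ModuleCat.{0} R) n).map f.op).app Y (cls P Y n a) = cls P' Y n a' := by
  obtain ⟨z, h1, h2⟩ := exists_cls P Y n a
  obtain ⟨z', h1', h2'⟩ := exists_cls P' Y n a'
  rw [h2, h2']
  apply map_ofCocycles P P' f τ hτ
  rw [h1', h]
  exact congrArg _ h1.symm

end General

section Cyclic

variable (J : Ideal R)

/-- A chosen projective resolution of `R ⧸ J`. -/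
noncomputable abbrev res : ProjectiveResolution (ModuleCat.of R (R ⧸ J)) :=
  projectiveResolution _

/-- The augmentation `P₀ → R ⧸ J`. -/
noncomputable def aug : (res J).complex.X 0 →ₗ[R] R ⧸ J := ((res J).π.f 0).hom

/-- The differential `P₁ → P₀`. -/
noncomputable def dOne : (res J).complex.X 1 →ₗ[R] (res J).complex.X 0 :=
  ((res J).complex.d 1 0).hom

/-- The differential `P₂ → P₁`. -/
noncomputable def dTwo : (res J).complex.X 2 →ₗ[R] (res J).complex.X 1 :=
  ((res J).complex.d 2 1).hom

lemma aug_surjective : Function.Surjective (aug J) :=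
  (ModuleCat.epi_iff_surjective _).1 (inferInstanceAs (Epi ((res J).π.f 0)))

lemma exact_dOne_aug : Function.Exact (dOne J) (aug J) :=
  (ShortComplex.ShortExact.moduleCat_exact_iff_function_exact _).1 (res J).exact₀

lemma exact_dTwo_dOne : Function.Exact (dTwo J) (dOne J) :=
  (ShortComplex.ShortExact.moduleCat_exact_iff_function_exact _).1 ((res J).exact_succ 0)

lemma exists_lift : ∃ κ : (res J).complex.X 0 →ₗ[R] R, J.mkQ ∘ₗ κ = aug J := by
  have := (res J).projective 0
  have : Module.Projective R ((res J).complex.X 0) :=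
    (IsProjective.iff_projective _).2 this
  exact Module.projective_lifting_property _ _ J.mkQ_surjective

lemma exists_section : ∃ σ : R →ₗ[R] (res J).complex.X 0, aug J ∘ₗ σ = J.mkQ :=
  Module.projective_lifting_property _ _ (aug_surjective J)

end Cyclic

section Cyclic

variable (J : Ideal R)

/-- A chosen lift `P₀ → R` of the augmentation. -/
noncomputable def lift₀ : (res J).complex.X 0 →ₗ[R] R := (exists_lift J).choose

lemma mk_lift₀ (x) : J.mkQ (lift₀ J x) = aug J x :=
  LinearMap.congr_fun (exists_lift J).choose_spec x

/-- The map `P₁ → J` induced by `lift₀`. -/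
noncomputable def lift₁ : (res J).complex.X 1 →ₗ[R] J :=
  (lift₀ J ∘ₗ dOne J).codRestrict J fun x => by
    have h := mk_lift₀ J (dOne J x)
    rw [(exact_dOne_aug J).apply_apply_eq_zero] at h
    exact Ideal.Quotient.eq_zero_iff_mem.1 h

lemma coe_lift₁ (x) : (lift₁ J x : R) = lift₀ J (dOne J x) := rfl

lemma lift₁_dTwo (x) : lift₁ J (dTwo J x) = 0 := by
  apply Subtype.ext
  rw [coe_lift₁, (exact_dTwo_dOne J).apply_apply_eq_zero]
  simp

variable (M : Type) [AddCommGroup M] [Module R M]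

/-- The degree one cocycle attached to a linear map `J → M`. -/
noncomputable def cocycleOne : (J →ₗ[R] M) →ₗ[R] cocycles (res J) (ModuleCat.of R M) 1 where
  toFun φ := ⟨ModuleCat.ofHom (φ ∘ₗ lift₁ J), by
    rw [mem_cocycles]
    ext x
    change φ (lift₁ J (dTwo J x)) = 0
    rw [lift₁_dTwo, map_zero]⟩
  map_add' _ _ := rfl
  map_smul' _ _ := rfl

/-- The degree zero cocycle attached to a linear map `R ⧸ J → M`. -/
noncomputable def cocycleZero :
    ((R ⧸ J) →ₗ[R] M) →ₗ[R] cocycles (res J) (ModuleCat.of R M) 0 where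
  toFun φ := ⟨ModuleCat.ofHom (φ ∘ₗ aug J), by
    rw [mem_cocycles]
    ext x
    change φ (aug J (dOne J x)) = 0
    rw [(exact_dOne_aug J).apply_apply_eq_zero, map_zero]⟩
  map_add' _ _ := rfl
  map_smul' _ _ := rfl

/-- The class in `Ext¹(R ⧸ J, M)` of a linear map `J → M`. -/
noncomputable def extOne : (J →ₗ[R] M) →ₗ[R]
    ((Ext R (ModuleCat.{0} R) 1).obj (op (ModuleCat.of R (R ⧸ J)))).obj (ModuleCat.of R M) :=
  cls _ _ _ ∘ₗ cocycleOne J M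

/-- The class in `Ext⁰(R ⧸ J, M)` of a linear map `R ⧸ J → M`. -/
noncomputable def extZero : ((R ⧸ J) →ₗ[R] M) →ₗ[R]
    ((Ext R (ModuleCat.{0} R) 0).obj (op (ModuleCat.of R (R ⧸ J)))).obj (ModuleCat.of R M) :=
  cls _ _ _ ∘ₗ cocycleZero J M

variable {M}

lemma extOne_eq_zero_iff (φ : J →ₗ[R] M) :
    extOne J M φ = 0 ↔ ∃ m : M, ∀ r : J, φ r = (r : R) • m := by
  obtain ⟨σ, hσ⟩ := exists_section J
  have hσ' (x : R) : aug J (σ x) = J.mkQ x := LinearMap.congr_fun hσ x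
  refine (cls_eq_zero_iff (res J) (ModuleCat.of R M) 1 0 (by simp) _).trans ?_
  constructor
  · rintro ⟨g, hg⟩
    have hg' (p) : φ (lift₁ J p) = g.hom (dOne J p) :=
      LinearMap.congr_fun (congrArg ModuleCat.Hom.hom hg) p
    have hρ (x : R) : x - lift₀ J (σ x) ∈ J := by
      rw [← Submodule.Quotient.mk_eq_zero, Submodule.Quotient.mk_sub, sub_eq_zero]
      exact ((mk_lift₀ J (σ x)).trans (hσ' x)).symm
    refine ⟨g.hom (σ 1) + φ ⟨1 - lift₀ J (σ 1), hρ 1⟩, fun r => ?_⟩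
    have h0 : aug J (σ r) = 0 := by
      rw [hσ']
      exact Ideal.Quotient.eq_zero_iff_mem.2 r.2
    obtain ⟨p, hp⟩ := (exact_dOne_aug J _).1 h0
    have h1 : r = lift₁ J p + (r : R) • ⟨1 - lift₀ J (σ 1), hρ 1⟩ := by
      apply Subtype.ext
      simp only [Submodule.coe_add, coe_lift₁, hp, Submodule.coe_smul, smul_eq_mul, mul_sub,
        mul_one]
      have h2 : σ (r : R) = (r : R) • σ 1 := by rw [← map_smul, smul_eq_mul, mul_one]
      rw [h2, map_smul, smul_eq_mul]
      ring
    have h2 : σ (r : R) = (r : R) • σ 1 := by rw [← map_smul, smul_eq_mul, mul_one]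
    calc φ r = φ (lift₁ J p + (r : R) • ⟨1 - lift₀ J (σ 1), hρ 1⟩) := congrArg φ h1
      _ = _ := by rw [map_add, map_smul, hg', hp, h2, map_smul, smul_add]
  · rintro ⟨m, hm⟩
    refine ⟨ModuleCat.ofHom (LinearMap.toSpanSingleton R M m ∘ₗ lift₀ J), ?_⟩
    ext p
    exact hm (lift₁ J p)

lemma extOne_surjective : Function.Surjective (extOne J M) := by
  obtain ⟨σ, hσ⟩ := exists_section J
  have hσ' (x : R) : aug J (σ x) = J.mkQ x := LinearMap.congr_fun hσ x
  intro x
  obtain ⟨⟨f, hf⟩, rfl⟩ := cls_surjective (res J) (ModuleCat.of R M) 1 x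
  have hf' (p) : f.hom (dTwo J p) = 0 :=
    LinearMap.congr_fun (congrArg ModuleCat.Hom.hom ((mem_cocycles _ _ _ _).1 hf)) p
  let e : LinearMap.range (dOne J) →ₗ[R] M :=
    (LinearMap.ker (dOne J)).liftQ f.hom (by
      intro p hp
      obtain ⟨q, rfl⟩ := (exact_dTwo_dOne J p).1 hp
      exact hf' q) ∘ₗ (dOne J).quotKerEquivRange.symm.toLinearMap
  have he (p) (h) : e ⟨dOne J p, h⟩ = f.hom p := by
    have : (dOne J).quotKerEquivRange.symm ⟨dOne J p, h⟩ = Submodule.Quotient.mk p := by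
      rw [LinearEquiv.symm_apply_eq]
      rfl
    simp only [e, LinearMap.comp_apply, LinearEquiv.coe_coe, this]
    rfl
  have hmem (p) (hp : aug J p = 0) : p ∈ LinearMap.range (dOne J) := (exact_dOne_aug J p).1 hp
  let φ : J →ₗ[R] M := e ∘ₗ (σ ∘ₗ J.subtype).codRestrict (LinearMap.range (dOne J))
    (fun r => hmem _ (by
      rw [LinearMap.comp_apply, hσ']
      exact Ideal.Quotient.eq_zero_iff_mem.2 r.2))
  let δ : (res J).complex.X 0 →ₗ[R] LinearMap.range (dOne J) :=
    (LinearMap.id - σ ∘ₗ lift₀ J).codRestrict _ (fun p => hmem _ (by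
      simp [hσ', ← mk_lift₀ J p]))
  refine ⟨φ, ?_⟩
  rw [← sub_eq_zero]
  change cls _ _ _ (cocycleOne J M φ) - _ = 0
  rw [← map_sub, cls_eq_zero_iff (res J) (ModuleCat.of R M) 1 0 (by simp)]
  refine ⟨ModuleCat.ofHom (-(e ∘ₗ δ)), ?_⟩
  ext p
  change φ (lift₁ J p) - f.hom p = -(e (δ (dOne J p)))
  have h1 : φ (lift₁ J p) = e ⟨dOne J p, LinearMap.mem_range_self _ p⟩ - e (δ (dOne J p)) := by
    rw [← map_sub]
    change e _ = e _
    congr 1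
    apply Subtype.ext
    change σ (lift₀ J (dOne J p)) = dOne J p - (dOne J p - σ (lift₀ J (dOne J p)))
    rw [sub_sub_cancel]
  rw [h1, he, sub_sub_cancel_left]

lemma extZero_injective : Function.Injective (extZero J M) := by
  rw [injective_iff_map_eq_zero]
  intro φ h
  obtain ⟨g, hg⟩ := (cls_eq_zero_iff (res J) (ModuleCat.of R M) 0 0 (by simp) _).1 h
  have hg' (p) : φ (aug J p) = 0 := by
    rw [HomologicalComplex.shape _ _ _ (by simp), zero_comp] at hg
    exact LinearMap.congr_fun (congrArg ModuleCat.Hom.hom hg) p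
  ext
  obtain ⟨p, hp⟩ := aug_surjective J (Submodule.Quotient.mk 1)
  have := hg' p
  rw [hp] at this
  simpa using this

lemma extZero_surjective : Function.Surjective (extZero J M) := by
  intro x
  obtain ⟨⟨f, hf⟩, rfl⟩ := cls_surjective (res J) (ModuleCat.of R M) 0 x
  have hf' (p) : f.hom (dOne J p) = 0 :=
    LinearMap.congr_fun (congrArg ModuleCat.Hom.hom ((mem_cocycles _ _ _ _).1 hf)) p
  let e : (R ⧸ J) →ₗ[R] M :=
    (LinearMap.ker (aug J)).liftQ f.hom (by
      intro p hp
      obtain ⟨q, rfl⟩ := (exact_dOne_aug J p).1 hp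
      exact hf' q) ∘ₗ ((aug J).quotKerEquivOfSurjective (aug_surjective J)).symm.toLinearMap
  have he (p) : e (aug J p) = f.hom p := by
    have : ((aug J).quotKerEquivOfSurjective (aug_surjective J)).symm (aug J p)
        = Submodule.Quotient.mk p := by
      rw [LinearEquiv.symm_apply_eq]
      rfl
    simp only [e, LinearMap.comp_apply, LinearEquiv.coe_coe, this]
    rfl
  refine ⟨e, ?_⟩
  change cls _ _ _ (cocycleZero J M e) = _
  congr 1
  apply Subtype.ext
  ext p
  exact he p

variable {J} {J' : Ideal R} (h : J' ≤ J)

/-- The projection `R ⧸ J' → R ⧸ J`. -/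
noncomputable def proj : ModuleCat.of R (R ⧸ J') ⟶ ModuleCat.of R (R ⧸ J) :=
  ModuleCat.ofHom (Submodule.mapQ J' J LinearMap.id h)

/-- A lift of the projection `R ⧸ J' → R ⧸ J` to projective resolutions. -/
noncomputable def projLift : (res J').complex ⟶ (res J).complex :=
  ProjectiveResolution.lift (proj h) _ _

lemma projLift_comm :
    (projLift h).f 0 ≫ (res J).π.f 0 = (res J').π.f 0 ≫ proj h :=
  ProjectiveResolution.lift_commutes_zero _ _ _

lemma aug_projLift (p) : aug J (((projLift h).f 0).hom p) =
    Submodule.mapQ J' J LinearMap.id h (aug J' p) :=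
  LinearMap.congr_fun (congrArg ModuleCat.Hom.hom (projLift_comm h)) p

lemma dOne_projLift (p) : dOne J (((projLift h).f 1).hom p) =
    ((projLift h).f 0).hom (dOne J' p) :=
  LinearMap.congr_fun (congrArg ModuleCat.Hom.hom ((projLift h).comm 1 0)) p

lemma map_extZero (φ : (R ⧸ J) →ₗ[R] M) :
    ((Ext R (ModuleCat.{0} R) 0).map (proj h).op).app (ModuleCat.of R M) (extZero J M φ) =
      extZero J' M (φ ∘ₗ Submodule.mapQ J' J LinearMap.id h) := by
  apply map_cls _ _ _ _ _ _ (projLift_comm h)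
  ext p
  exact congrArg φ (aug_projLift h p).symm

lemma map_extOne (φ : J →ₗ[R] M) :
    ((Ext R (ModuleCat.{0} R) 1).map (proj h).op).app (ModuleCat.of R M) (extOne J M φ) =
      extOne J' M (φ ∘ₗ Submodule.inclusion h) := by
  let a : cocycles (res J') (ModuleCat.of R M) 1 :=
    ⟨(projLift h).f 1 ≫ (cocycleOne J M φ).1, by
      rw [mem_cocycles, ← HomologicalComplex.Hom.comm_assoc,
        (mem_cocycles _ _ _ _).1 (cocycleOne J M φ).2, comp_zero]⟩
  have h1 := map_cls (res J) (ModuleCat.of R M) 1 (res J') (proj h) (projLift h)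
    (projLift_comm h) (cocycleOne J M φ) a rfl
  refine h1.trans ?_
  change _ = cls _ _ _ (cocycleOne J' M _)
  rw [← sub_eq_zero, ← map_sub, cls_eq_zero_iff (res J') (ModuleCat.of R M) 1 0 (by simp)]
  let δ : (res J').complex.X 0 →ₗ[R] J :=
    (lift₀ J ∘ₗ ((projLift h).f 0).hom - lift₀ J').codRestrict J fun p => by
      rw [← Submodule.Quotient.mk_eq_zero, LinearMap.sub_apply, Submodule.Quotient.mk_sub,
        sub_eq_zero]
      refine (mk_lift₀ J _).trans ?_
      rw [aug_projLift, ← mk_lift₀]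
      rfl
  refine ⟨ModuleCat.ofHom (φ ∘ₗ δ), ?_⟩
  ext p
  change φ (lift₁ J (((projLift h).f 1).hom p)) - φ (Submodule.inclusion h (lift₁ J' p)) =
    φ (δ (dOne J' p))
  rw [← map_sub]
  congr 1
  apply Subtype.ext
  change lift₀ J (dOne J _) - lift₀ J' _ = lift₀ J _ - lift₀ J' _
  rw [dOne_projLift]

end Cyclic

section Local

variable (I : Ideal R) (M : Type) [AddCommGroup M] [Module R M]

/-- The structure map from `Ext` to local cohomology. -/
noncomputable def toLC (i n : ℕ) :
    ((Ext R (ModuleCat.{0} R) i).obj (op (ModuleCat.of R (R ⧸ I ^ n)))).obj (ModuleCat.of R M) ⟶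
      (localCohomology I i).obj (ModuleCat.of R M) :=
  (colimit.ι (localCohomology.diagram (localCohomology.idealPowersDiagram I) i) (op (op n))).app
    (ModuleCat.of R M)

/-- The directed system whose colimit is local cohomology. -/
noncomputable abbrev lcDiagram (i : ℕ) : ℕᵒᵖᵒᵖ ⥤ ModuleCat.{0} R :=
  localCohomology.diagram (localCohomology.idealPowersDiagram I) i ⋙
    (evaluation _ _).obj (ModuleCat.of R M)

/-- The colimit cocone defining local cohomology. -/
noncomputable abbrev lcCocone (i : ℕ) : Cocone (lcDiagram I M i) :=
  ((evaluation _ _).obj (ModuleCat.of R M)).mapCocone (colimit.cocone _)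

/-- Local cohomology is a colimit of modules. -/
noncomputable def isColimit_lcCocone (i : ℕ) : IsColimit (lcCocone I M i) :=
  isColimitOfPreserves _ (colimit.isColimit _)

instance : IsFiltered ℕᵒᵖᵒᵖ := IsFiltered.of_equivalence (opOpEquivalence ℕ).symm

lemma exists_toLC (i : ℕ) (x : (localCohomology I i).obj (ModuleCat.of R M)) :
    ∃ n y, toLC I M i n y = x := by
  obtain ⟨j, y, hy⟩ := Concrete.isColimit_exists_rep _ (isColimit_lcCocone I M i) x
  exact ⟨j.unop.unop, y, hy⟩

lemma toLC_map (i : ℕ) {n k : ℕ} (h : n ≤ k) (y) :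
    toLC I M i k (((Ext R (ModuleCat.{0} R) i).map
      (proj (Ideal.pow_le_pow_right (I := I) h)).op).app (ModuleCat.of R M) y) =
      toLC I M i n y := by
  have := (lcCocone I M i).w (homOfLE h).op.op
  exact LinearMap.congr_fun (congrArg ModuleCat.Hom.hom this) y

lemma toLC_eq_zero (i : ℕ) {n : ℕ} (y) (h : toLC I M i n y = 0) :
    ∃ k, ∃ h : n ≤ k, ((Ext R (ModuleCat.{0} R) i).map
      (proj (Ideal.pow_le_pow_right (I := I) h)).op).app (ModuleCat.of R M) y = 0 := by
  have h0 : toLC I M i n y = toLC I M i n 0 := by rw [h, map_zero]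
  obtain ⟨k, f, g, hfg⟩ := (Concrete.isColimit_rep_eq_iff_exists (lcDiagram I M i)
    (isColimit_lcCocone I M i) (i := op (op n)) (j := op (op n)) y
    (0 : (lcDiagram I M i).obj (op (op n)))).1 h0
  refine ⟨k.unop.unop, f.unop.unop.le, ?_⟩
  exact hfg.trans (map_zero ((lcDiagram I M i).map g).hom)

/-- The class in `H¹_I(M)` of a linear map `I ^ n → M`. -/
noncomputable def lcOne (n : ℕ) :
    (↥(I ^ n) →ₗ[R] M) →ₗ[R] (localCohomology I 1).obj (ModuleCat.of R M) :=
  (toLC I M 1 n).hom ∘ₗ extOne (I ^ n) M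

lemma exists_lcOne (x : (localCohomology I 1).obj (ModuleCat.of R M)) :
    ∃ n φ, lcOne I M n φ = x := by
  obtain ⟨n, y, rfl⟩ := exists_toLC I M 1 x
  obtain ⟨φ, rfl⟩ := extOne_surjective (I ^ n) y
  exact ⟨n, φ, rfl⟩

variable {M}

lemma lcOne_restrict {n k : ℕ} (h : n ≤ k) (φ : ↥(I ^ n) →ₗ[R] M) :
    lcOne I M k (φ ∘ₗ Submodule.inclusion (Ideal.pow_le_pow_right h)) = lcOne I M n φ := by
  have h1 := toLC_map I M 1 h (extOne (I ^ n) M φ)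
  rw [map_extOne] at h1
  exact h1

lemma lcOne_eq_zero_iff (n : ℕ) (φ : ↥(I ^ n) →ₗ[R] M) :
    lcOne I M n φ = 0 ↔
      ∃ k, ∃ h : n ≤ k, ∃ z : M, ∀ r : ↥(I ^ k),
        φ (Submodule.inclusion (Ideal.pow_le_pow_right h) r) = (r : R) • z := by
  constructor
  · intro h
    obtain ⟨k, hk, h⟩ := toLC_eq_zero I M 1 _ h
    rw [map_extOne, extOne_eq_zero_iff] at h
    exact ⟨k, hk, h⟩
  · rintro ⟨k, hk, h⟩
    rw [← lcOne_restrict I hk]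
    change toLC I M 1 k (extOne (I ^ k) M _) = 0
    rw [(extOne_eq_zero_iff _ _).2 h]
    exact map_zero (toLC I M 1 k).hom

variable (M)

/-- The submodule of elements killed by a power of `I`. -/
def powTorsion : Submodule R M where
  carrier := {z | ∃ n, ∀ r ∈ I ^ n, r • z = 0}
  zero_mem' := ⟨0, by simp⟩
  add_mem' := by
    rintro a b ⟨n, hn⟩ ⟨k, hk⟩
    refine ⟨n + k, fun r hr => ?_⟩
    rw [smul_add, hn r (Ideal.pow_le_pow_right (by omega) hr),
      hk r (Ideal.pow_le_pow_right (by omega) hr), add_zero]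
  smul_mem' := by
    rintro c a ⟨n, hn⟩
    exact ⟨n, fun r hr => by rw [smul_comm, hn r hr, smul_zero]⟩

variable {I M} in
lemma mem_powTorsion {z : M} : z ∈ powTorsion I M ↔ ∃ n, ∀ r ∈ I ^ n, r • z = 0 := Iff.rfl

/-- The linear map `R ⧸ J → M` sending `1` to `z`. -/
def ofKilled (J : Ideal R) (z : M) (h : ∀ r ∈ J, r • z = 0) : (R ⧸ J) →ₗ[R] M :=
  J.liftQ (LinearMap.toSpanSingleton R M z) h

@[simp]
lemma ofKilled_one (J : Ideal R) (z : M) (h : ∀ r ∈ J, r • z = 0) :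
    ofKilled M J z h 1 = z := one_smul R z

/-- The class in `H⁰_I(M)` of an element killed by `I ^ n`. -/
noncomputable def lcZero (n : ℕ) :
    ((R ⧸ I ^ n) →ₗ[R] M) →ₗ[R] (localCohomology I 0).obj (ModuleCat.of R M) :=
  (toLC I M 0 n).hom ∘ₗ extZero (I ^ n) M

lemma lcZero_injective (n : ℕ) : Function.Injective (lcZero I M n) := by
  rw [injective_iff_map_eq_zero]
  intro φ h
  obtain ⟨k, hk, h⟩ := toLC_eq_zero I M 0 _ h
  rw [map_extZero] at h
  have h2 := extZero_injective (I ^ k) (h.trans (map_zero _).symm)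
  ext
  exact LinearMap.congr_fun h2 (Submodule.Quotient.mk 1)

variable {M} in
lemma lcZero_ofKilled {n k : ℕ} (hnk : n ≤ k) (z : M) (hn : ∀ r ∈ I ^ n, r • z = 0)
    (hk : ∀ r ∈ I ^ k, r • z = 0) :
    lcZero I M n (ofKilled M _ z hn) = lcZero I M k (ofKilled M _ z hk) := by
  have h1 := toLC_map I M 0 hnk (extZero (I ^ n) M (ofKilled M _ z hn))
  rw [map_extZero] at h1
  refine h1.symm.trans ?_
  change lcZero I M k _ = lcZero I M k _
  congr 1
  ext
  rfl

variable {M} in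
lemma lcZero_ofKilled' {n k : ℕ} (z : M) (hn : ∀ r ∈ I ^ n, r • z = 0)
    (hk : ∀ r ∈ I ^ k, r • z = 0) :
    lcZero I M n (ofKilled M _ z hn) = lcZero I M k (ofKilled M _ z hk) := by
  rcases le_total n k with h | h
  · exact lcZero_ofKilled I h z hn hk
  · exact (lcZero_ofKilled I h z hk hn).symm

/-- `H⁰_I(M)` is the submodule of elements killed by a power of `I`. -/
noncomputable def powTorsionEquiv :
    powTorsion I M ≃ₗ[R] (localCohomology I 0).obj (ModuleCat.of R M) := by
  let F : powTorsion I M →ₗ[R] (localCohomology I 0).obj (ModuleCat.of R M) :=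
    { toFun := fun z => lcZero I M _ (ofKilled M _ z.1 (mem_powTorsion.1 z.2).choose_spec)
      map_add' := by
        intro a b
        obtain ⟨n, hn⟩ := mem_powTorsion.1 a.2
        obtain ⟨k, hk⟩ := mem_powTorsion.1 b.2
        have ha : ∀ r ∈ I ^ (n + k), r • a.1 = 0 := fun r hr =>
          hn r (Ideal.pow_le_pow_right (by omega) hr)
        have hb : ∀ r ∈ I ^ (n + k), r • b.1 = 0 := fun r hr =>
          hk r (Ideal.pow_le_pow_right (by omega) hr)
        have hab : ∀ r ∈ I ^ (n + k), r • (a + b).1 = 0 := fun r hr => by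
          rw [Submodule.coe_add, smul_add, ha r hr, hb r hr, add_zero]
        rw [lcZero_ofKilled' I _ _ ha, lcZero_ofKilled' I _ _ hb, lcZero_ofKilled' I _ _ hab,
          ← map_add]
        congr 1
        ext
        simp
      map_smul' := by
        intro c a
        obtain ⟨n, ha⟩ := mem_powTorsion.1 a.2
        have hab : ∀ r ∈ I ^ n, r • (c • a).1 = 0 := fun r hr => by
          rw [Submodule.coe_smul, smul_comm, ha r hr, smul_zero]
        rw [lcZero_ofKilled' I _ _ ha, lcZero_ofKilled' I _ _ hab, RingHom.id_apply, ← map_smul]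
        congr 1
        ext
        simp }
  refine LinearEquiv.ofBijective F ⟨?_, ?_⟩
  · rw [injective_iff_map_eq_zero]
    intro a ha
    have := LinearMap.congr_fun (lcZero_injective I M _ (ha.trans (map_zero _).symm))
      (Submodule.Quotient.mk 1)
    apply Subtype.ext
    simpa using this
  · intro x
    obtain ⟨n, y, rfl⟩ := exists_toLC I M 0 x
    obtain ⟨φ, rfl⟩ := extZero_surjective (I ^ n) y
    have hz : ∀ r ∈ I ^ n, r • φ (Submodule.Quotient.mk 1) = 0 := fun r hr => by
      rw [← map_smul, ← Submodule.Quotient.mk_smul, smul_eq_mul, mul_one,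
        (Submodule.Quotient.mk_eq_zero _).2 hr, map_zero]
    refine ⟨⟨_, n, hz⟩, ?_⟩
    refine (lcZero_ofKilled' I (φ (Submodule.Quotient.mk 1)) _ hz).trans ?_
    change lcZero I M n _ = lcZero I M n _
    congr 1
    ext
    simp

end Local

end ExtClass

namespace HilbertCoeff

open ExtClass (powTorsion mem_powTorsion lcOne exists_lcOne lcOne_restrict lcOne_eq_zero_iff
  powTorsionEquiv)

lemma choose_le_pow (n j : ℕ) : (n + j).choose j ≤ (n + 1) ^ j := by
  induction j with
  | zero => simp
  | succ j ih =>
    have h := Nat.add_one_mul_choose_eq (n + j) j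
    have h2 : (n + j + 1) ≤ (n + 1) * (j + 1) := by nlinarith [Nat.zero_le (n * j)]
    have : (n + j + 1).choose (j + 1) * (j + 1) ≤ (n + 1) ^ (j + 1) * (j + 1) := by
      rw [← h, pow_succ]
      calc (n + j + 1) * (n + j).choose j ≤ ((n + 1) * (j + 1)) * (n + 1) ^ j :=
            Nat.mul_le_mul h2 ih
        _ = _ := by ring
    exact Nat.le_of_mul_le_mul_right this (Nat.succ_pos j)

lemma pow_le_choose_mul (n j : ℕ) : (n + 1) ^ j ≤ (n + j).choose j * j.factorial := by
  rw [mul_comm, ← Nat.ascFactorial_eq_factorial_mul_choose]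
  exact Nat.pow_succ_le_ascFactorial (n + 1) j

/-- A combination of binomial polynomials of growth order at most `t` involves only those of
degree at most `t`. -/
lemma coeff_eq_zero (c : ℕ → ℤ) (t L N s : ℕ)
    (h : ∀ n ≥ N, |∑ j ∈ Finset.range (s + 1), c j * ((n + j).choose j : ℤ)| ≤
      (L : ℤ) * ((n : ℤ) + 1) ^ t) (j : ℕ) (htj : t < j) (hjs : j ≤ s) : c j = 0 := by
  induction s with
  | zero => omega
  | succ s ih =>
    have hs : c (s + 1) = 0 := by
      by_contra hc
      have hc1 : 1 ≤ |c (s + 1)| := Int.one_le_abs hc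
      set K : ℤ := (L + ∑ j ∈ Finset.range (s + 1), |c j|) * ((s + 1).factorial : ℤ) with hK
      obtain ⟨n, hn, hnK⟩ : ∃ n : ℕ, N ≤ n ∧ K < n + 1 :=
        ⟨N + K.toNat, by omega, by have := Int.self_le_toNat K; push_cast; linarith⟩
      have h1 := h n hn
      rw [Finset.sum_range_succ] at h1
      have hpos : (0 : ℤ) < (n : ℤ) + 1 := by positivity
      have h2 : |∑ j ∈ Finset.range (s + 1), c j * ((n + j).choose j : ℤ)| ≤
          (∑ j ∈ Finset.range (s + 1), |c j|) * ((n : ℤ) + 1) ^ s := by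
        refine (Finset.abs_sum_le_sum_abs _ _).trans ?_
        rw [Finset.sum_mul]
        refine Finset.sum_le_sum fun j hj => ?_
        rw [abs_mul]
        refine mul_le_mul_of_nonneg_left ?_ (abs_nonneg _)
        rw [abs_of_nonneg (by positivity)]
        calc ((n + j).choose j : ℤ) ≤ ((n : ℤ) + 1) ^ j := by exact_mod_cast choose_le_pow n j
          _ ≤ ((n : ℤ) + 1) ^ s :=
            pow_le_pow_right₀ (by linarith) (by simpa [Nat.lt_succ_iff] using hj)
      have h3 : (L : ℤ) * ((n : ℤ) + 1) ^ t ≤ L * ((n : ℤ) + 1) ^ s :=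
        mul_le_mul_of_nonneg_left (pow_le_pow_right₀ (by linarith) (by omega)) (by positivity)
      have h4 : |c (s + 1) * ((n + (s + 1)).choose (s + 1) : ℤ)| ≤
          (L + ∑ j ∈ Finset.range (s + 1), |c j|) * ((n : ℤ) + 1) ^ s := by
        have := abs_sub_abs_le_abs_sub (c (s + 1) * ((n + (s + 1)).choose (s + 1) : ℤ))
          (-∑ j ∈ Finset.range (s + 1), c j * ((n + j).choose j : ℤ))
        rw [abs_neg, sub_neg_eq_add, add_comm (c (s + 1) * _)] at this
        linarith
      have h5 : ((n + (s + 1)).choose (s + 1) : ℤ) ≤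
          |c (s + 1) * ((n + (s + 1)).choose (s + 1) : ℤ)| := by
        rw [abs_mul, abs_of_nonneg (a := (((n + (s + 1)).choose (s + 1) : ℕ) : ℤ)) (by positivity)]
        exact le_mul_of_one_le_left (by positivity) hc1
      have h6 : ((n : ℤ) + 1) ^ (s + 1) ≤
          ((n + (s + 1)).choose (s + 1) : ℤ) * ((s + 1).factorial : ℤ) := by
        exact_mod_cast pow_le_choose_mul n (s + 1)
      have h7 : ((n : ℤ) + 1) ^ (s + 1) ≤ K * ((n : ℤ) + 1) ^ s := by
        refine h6.trans ((mul_le_mul_of_nonneg_right (h5.trans h4) (by positivity)).trans ?_)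
        rw [hK]
        apply le_of_eq
        ring
      rw [pow_succ'] at h7
      exact absurd (le_of_mul_le_mul_right h7 (by positivity)) (not_le.2 hnK)
    rcases Nat.lt_or_ge s j with hj | hj
    · rwa [show j = s + 1 by omega]
    · refine ih (fun n hn => ?_) hj
      have := h n hn
      rwa [Finset.sum_range_succ, hs, zero_mul, add_zero] at this

/-- If the difference of two combinations of binomial polynomials is eventually constant, then the
coefficients in positive degrees agree. -/
lemma coeff_eq_of_sub_eq_const (c d : ℕ → ℤ) (a : ℤ) (N s : ℕ)
    (h : ∀ n ≥ N, ∑ j ∈ Finset.range (s + 1), c j * ((n + j).choose j : ℤ) =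
      ∑ j ∈ Finset.range (s + 1), d j * ((n + j).choose j : ℤ) + a) :
    (∀ j, 0 < j → j ≤ s → c j = d j) ∧ c 0 = d 0 + a := by
  have key : ∀ n ≥ N, ∑ j ∈ Finset.range (s + 1), (c j - d j) * ((n + j).choose j : ℤ) = a := by
    intro n hn
    simp only [sub_mul, Finset.sum_sub_distrib, h n hn]
    ring
  have h1 : ∀ j, 0 < j → j ≤ s → c j - d j = 0 := fun j hj hjs =>
    coeff_eq_zero (fun j => c j - d j) 0 a.natAbs N s (fun n hn => by rw [key n hn]; simp) j hj hjs
  refine ⟨fun j hj hjs => sub_eq_zero.1 (h1 j hj hjs), ?_⟩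
  have h2 := key N le_rfl
  rw [Finset.sum_range_succ', Finset.sum_eq_zero fun j hj => by
    rw [h1 _ (Nat.succ_pos j) (by simpa [Nat.succ_le_iff] using hj), zero_mul]] at h2
  simp at h2
  linarith

lemma sum_choose_sub (c : ℕ → ℤ) (s n : ℕ) :
    ∑ j ∈ Finset.range (s + 1 + 1), c j * ((n + 1 + j).choose j : ℤ) -
      ∑ j ∈ Finset.range (s + 1 + 1), c j * ((n + j).choose j : ℤ) =
      ∑ j ∈ Finset.range (s + 1), c (j + 1) * ((n + 1 + j).choose j : ℤ) := by
  rw [Finset.sum_range_succ', Finset.sum_range_succ' _ (s + 1)]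
  simp only [Nat.choose_zero_right, add_sub_add_right_eq_sub, ← Finset.sum_sub_distrib]
  refine Finset.sum_congr rfl fun j _ => ?_
  rw [← mul_sub, show n + 1 + (j + 1) = (n + 1 + j) + 1 by ring, Nat.choose_succ_succ,
    show n + (j + 1) = n + 1 + j by ring]
  push_cast
  ring

lemma mLength_eq_iff {R : Type} [CommRing R] {M : Type} [AddCommGroup M] [Module R M] (k : ℕ) :
    mLength R M = ((k : ℕ∞) : WithBot ℕ∞) ↔ Module.length R M = k := by
  rw [mLength, ← Module.coe_length, WithBot.coe_inj]

/-- The Hilbert function in the standard binomial basis. -/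
lemma exists_hilbertFunction {R : Type} [CommRing R] [IsLocalRing R] {I : Ideal R} {M : Type}
    [AddCommGroup M] [Module R M] {t : ℕ} {e : ℕ → ℤ} (h : HasHilbCoeffs R I M t e) :
    ∃ N : ℕ, ∃ l : ℕ → ℕ, ∀ n ≥ N,
      Module.length R (M ⧸ (I ^ (n + 1) • (⊤ : Submodule R M))) = l n ∧
      (l n : ℤ) = ∑ j ∈ Finset.range (t + 1),
        ((-1) ^ (t - j) * e (t - j)) * ((n + j).choose j : ℤ) := by
  obtain ⟨N, hN⟩ := h
  choose! l hl using hN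
  refine ⟨N, l, fun n hn => ⟨(mLength_eq_iff _).1 (hl n hn).1, ?_⟩⟩
  rw [(hl n hn).2, ← Finset.sum_range_reflect]
  refine Finset.sum_congr rfl fun j hj => ?_
  have hj : j ≤ t := by simpa [Nat.lt_succ_iff] using hj
  rw [show t + 1 - 1 - j = t - j by omega, show n + t - (t - j) = n + j by omega,
    show t - (t - j) = j by omega]

section Length

variable {R : Type} [CommRing R]

lemma mkQ_mem_smul_top_iff {M : Type} [AddCommGroup M] [Module R M] (N : Submodule R M)
    (J : Ideal R) (z : M) :
    N.mkQ z ∈ J • (⊤ : Submodule R (M ⧸ N)) ↔ z ∈ N ⊔ J • (⊤ : Submodule R M) := by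
  rw [← Submodule.comap_map_mkQ, Submodule.mem_comap, Submodule.map_smul'', Submodule.map_top,
    Submodule.range_mkQ]

lemma mem_span_singleton_smul_top {M : Type} [AddCommGroup M] [Module R M] (h : R) (z : M) :
    z ∈ Ideal.span {h} • (⊤ : Submodule R M) ↔ ∃ w, h • w = z := by
  rw [Submodule.ideal_span_singleton_smul, Submodule.mem_smul_pointwise_iff_exists]
  simp

lemma map_mem_smul_top {A B : Type} [AddCommGroup A] [Module R A] [AddCommGroup B] [Module R B]
    (f : A →ₗ[R] B) (J : Ideal R) {z : A} (hz : z ∈ J • (⊤ : Submodule R A)) :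
    f z ∈ J • (⊤ : Submodule R B) := by
  have h : f z ∈ (J • (⊤ : Submodule R A)).map f := Submodule.mem_map_of_mem hz
  rw [Submodule.map_smul''] at h
  exact Submodule.smul_mono le_rfl le_top h

/-- Length is additive along `A / f⁻¹(JB) → B / JB → C / JC`. -/
lemma length_quotient_smul_top {A B C : Type} [AddCommGroup A] [Module R A] [AddCommGroup B]
    [Module R B] [AddCommGroup C] [Module R C] (f : A →ₗ[R] B) (g : B →ₗ[R] C)
    (hg : Function.Surjective g) (hfg : Function.Exact f g) (J : Ideal R) :
    Module.length R (B ⧸ J • (⊤ : Submodule R B)) =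
      Module.length R (A ⧸ (J • (⊤ : Submodule R B)).comap f) +
        Module.length R (C ⧸ J • (⊤ : Submodule R C)) := by
  have hgJ : J • (⊤ : Submodule R B) ≤ (J • (⊤ : Submodule R C)).comap g :=
    fun z hz => map_mem_smul_top g J hz
  refine Module.length_eq_add_of_exact (Submodule.mapQ _ _ f le_rfl)
    (Submodule.mapQ _ _ g hgJ) ?_ ?_ ?_
  · rw [← LinearMap.ker_eq_bot, Submodule.ker_mapQ, ← Submodule.map_comap_eq_of_surjective
      (Submodule.mkQ_surjective _) ⊥]
    congr 1
    ext
    simp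
  · intro c
    obtain ⟨c, rfl⟩ := Submodule.mkQ_surjective _ c
    obtain ⟨b, rfl⟩ := hg c
    exact ⟨Submodule.Quotient.mk b, rfl⟩
  · intro b
    obtain ⟨b, rfl⟩ := Submodule.mkQ_surjective _ b
    constructor
    · intro hb
      have hb : g b ∈ J • (⊤ : Submodule R C) := (Submodule.Quotient.mk_eq_zero _).1 hb
      have hmap : (J • (⊤ : Submodule R B)).map g = J • (⊤ : Submodule R C) := by
        rw [Submodule.map_smul'', Submodule.map_top, LinearMap.range_eq_top.2 hg]
      rw [← hmap] at hb
      obtain ⟨b', hb', hbb⟩ := hb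
      obtain ⟨a, ha⟩ := (hfg (b - b')).1 (by rw [map_sub, hbb, sub_self])
      refine ⟨Submodule.Quotient.mk a, ?_⟩
      change Submodule.Quotient.mk (f a) = Submodule.Quotient.mk b
      rw [Submodule.Quotient.eq, ha]
      simpa using hb'
    · rintro ⟨a, ha⟩
      obtain ⟨a, rfl⟩ := Submodule.mkQ_surjective _ a
      rw [← ha]
      change Submodule.Quotient.mk (g (f a)) = 0
      rw [(hfg _).2 ⟨a, rfl⟩, Submodule.Quotient.mk_zero]

lemma exact_lsmul_mkQ {M : Type} [AddCommGroup M] [Module R M] (h : R) :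
    Function.Exact (LinearMap.lsmul R M h) (Ideal.span {h} • (⊤ : Submodule R M)).mkQ := by
  intro z
  rw [Submodule.mkQ_apply, Submodule.Quotient.mk_eq_zero, mem_span_singleton_smul_top]
  rfl

lemma exact_subtype_mkQ {M : Type} [AddCommGroup M] [Module R M] (N : Submodule R M) :
    Function.Exact N.subtype N.mkQ := by
  intro z
  rw [Submodule.mkQ_apply, Submodule.Quotient.mk_eq_zero]
  simp

lemma length_quotient_le_of_le {M : Type} [AddCommGroup M] [Module R M] {N N' : Submodule R M}
    (h : N ≤ N') : Module.length R (M ⧸ N') ≤ Module.length R (M ⧸ N) :=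
  Module.length_le_of_surjective (Submodule.factor h) (Submodule.factor_surjective h)

end Length

section Growth

variable {R : Type} [CommRing R] [IsLocalRing R] [IsNoetherianRing R]

lemma isArtinianRing_quotient_of_pow_le {J : Ideal R} {k : ℕ} (h : maximalIdeal R ^ k ≤ J) :
    IsArtinianRing (R ⧸ J) := by
  by_cases hJ : J = ⊤
  · have : Subsingleton (R ⧸ J) := Ideal.Quotient.subsingleton_iff.2 hJ
    infer_instance
  have : Nontrivial (R ⧸ J) := Ideal.Quotient.nontrivial_iff.mpr hJ
  have := IsLocalRing.of_surjective' (Ideal.Quotient.mk J) Ideal.Quotient.mk_surjective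
  have := IsLocalHom.of_surjective (Ideal.Quotient.mk J) Ideal.Quotient.mk_surjective
  have hmap : (maximalIdeal R).map (Ideal.Quotient.mk J) = maximalIdeal (R ⧸ J) := by
    ext x
    obtain ⟨x, rfl⟩ := Ideal.Quotient.mk_surjective x
    simp [sup_eq_left.mpr (le_maximalIdeal hJ)]
  rw [isArtinianRing_iff_isNilpotent_maximalIdeal]
  refine ⟨k, ?_⟩
  rw [← hmap, ← Ideal.map_pow, Ideal.zero_eq_bot, Ideal.map_eq_bot_iff_le_ker, Ideal.mk_ker]
  exact h

lemma isFiniteLength_of_pow_smul_eq_bot {A : Type} [AddCommGroup A] [Module R A]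
    [Module.Finite R A] {k : ℕ} (h : maximalIdeal R ^ k • (⊤ : Submodule R A) = ⊥) :
    IsFiniteLength R A := by
  rw [isFiniteLength_iff_isNoetherian_isArtinian]
  refine ⟨inferInstance, ?_⟩
  have := isArtinianRing_quotient_of_pow_le (le_refl (maximalIdeal R ^ k))
  have hT : Module.IsTorsionBySet R A (maximalIdeal R ^ k : Ideal R) := by
    rintro z ⟨r, hr⟩
    have : r • z ∈ maximalIdeal R ^ k • (⊤ : Submodule R A) :=
      Submodule.smul_mem_smul hr trivial
    rwa [h, Submodule.mem_bot] at this
  let _ := hT.module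
  have : IsScalarTower R (R ⧸ maximalIdeal R ^ k) A := hT.isScalarTower
  have : Module.Finite (R ⧸ maximalIdeal R ^ k) A := Module.Finite.of_restrictScalars_finite R _ _
  exact isArtinian_of_surjective_algebraMap (R := R ⧸ maximalIdeal R ^ k)
    Ideal.Quotient.mk_surjective

/-- The Hilbert function of a module with a system of `xs.length` elements generating an ideal of
definition grows at most like a polynomial of that degree. -/
lemma exists_length_le (xs : List R) : ∀ (A : Type) [AddCommGroup A] [Module R A]
    [Module.Finite R A], (∀ x ∈ xs, x ∈ maximalIdeal R) →
    (∃ k, maximalIdeal R ^ k • (⊤ : Submodule R A) ≤ Ideal.ofList xs • (⊤ : Submodule R A)) →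
    ∃ L : ℕ, ∀ n : ℕ, Module.length R (A ⧸ maximalIdeal R ^ n • (⊤ : Submodule R A)) ≤
      ((L * (n + 1) ^ xs.length : ℕ) : ℕ∞) := by
  induction xs with
  | nil =>
    rintro A _ _ _ - ⟨k, hk⟩
    have hA : IsFiniteLength R A := by
      refine isFiniteLength_of_pow_smul_eq_bot (k := k) (le_bot_iff.1 (hk.trans ?_))
      simp
    obtain ⟨L, hL⟩ := ENat.ne_top_iff_exists.1 (Module.length_ne_top_iff.2 hA)
    refine ⟨L, fun n => ?_⟩
    simp only [List.length_nil, pow_zero, mul_one, hL]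
    exact Module.length_le_of_surjective _ (Submodule.mkQ_surjective _)
  | cons x xs ih =>
    rintro A _ _ _ hx ⟨k, hk⟩
    obtain ⟨L, hL⟩ := ih (A ⧸ Ideal.span {x} • (⊤ : Submodule R A))
      (fun y hy => hx y (List.mem_cons_of_mem _ hy)) ⟨k, by
        intro z hz
        obtain ⟨z, rfl⟩ := Submodule.mkQ_surjective _ z
        rw [mkQ_mem_smul_top_iff] at hz ⊢
        rw [Ideal.ofList_cons, Submodule.sup_smul] at hk
        exact sup_le le_sup_left hk hz⟩
    refine ⟨L, fun n => ?_⟩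
    have key : ∀ n : ℕ, Module.length R (A ⧸ maximalIdeal R ^ n • (⊤ : Submodule R A)) ≤
        ((n * (L * (n + 1) ^ xs.length) : ℕ) : ℕ∞) := by
      intro n
      induction n with
      | zero =>
        have : Subsingleton (A ⧸ maximalIdeal R ^ 0 • (⊤ : Submodule R A)) := by
          rw [Submodule.Quotient.subsingleton_iff]
          simp
        rw [Module.length_eq_zero]
        exact bot_le
      | succ n ihn =>
        rw [length_quotient_smul_top (LinearMap.lsmul R A x) _ (Submodule.mkQ_surjective _)
          (exact_lsmul_mkQ x)]
        have h1 : maximalIdeal R ^ n • (⊤ : Submodule R A) ≤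
            (maximalIdeal R ^ (n + 1) • (⊤ : Submodule R A)).comap (LinearMap.lsmul R A x) := by
          intro z hz
          rw [Submodule.mem_comap, LinearMap.lsmul_apply, pow_succ', Submodule.mul_smul]
          exact Submodule.smul_mem_smul (hx x (by simp)) hz
        refine (add_le_add ((length_quotient_le_of_le h1).trans ihn) (hL (n + 1))).trans ?_
        have : n * (L * (n + 1) ^ xs.length) ≤ n * (L * (n + 1 + 1) ^ xs.length) := by gcongr; omega
        norm_cast
        rw [Nat.succ_mul]
        omega
    refine (key n).trans ?_
    rw [List.length_cons, pow_succ]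
    norm_cast
    nlinarith [Nat.zero_le (L * (n + 1) ^ xs.length)]

/-- Existence of systems of parameters. -/
lemma exists_system_of_parameters (A : Type) [AddCommGroup A] [Module R A] {t : ℕ}
    (ht : mDim R A = ((t : ℕ∞) : WithBot ℕ∞)) :
    ∃ xs : List R, xs.length = t ∧ (∀ x ∈ xs, x ∈ maximalIdeal R) ∧
      ∃ k, maximalIdeal R ^ k • (⊤ : Submodule R A) ≤ Ideal.ofList xs • (⊤ : Submodule R A) := by
  set J := Submodule.annihilator (⊤ : Submodule R A) with hJ
  rw [mDim, ← hJ] at ht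
  have hne : Nontrivial (R ⧸ J) := by
    by_contra hn
    rw [not_nontrivial_iff_subsingleton] at hn
    rw [ringKrullDim_eq_bot_of_subsingleton] at ht
    simp at ht
  have hJt : J ≠ ⊤ := Ideal.Quotient.nontrivial_iff.1 hne
  have := IsLocalRing.of_surjective' (Ideal.Quotient.mk J) Ideal.Quotient.mk_surjective
  have := IsLocalHom.of_surjective (Ideal.Quotient.mk J) Ideal.Quotient.mk_surjective
  obtain ⟨s, hs, hcard⟩ :=
    Ideal.exists_finset_card_eq_height_of_isNoetherianRing (maximalIdeal (R ⧸ J))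
  have hst : s.card = t := by
    have h1 := IsLocalRing.maximalIdeal_height_eq_ringKrullDim (R := R ⧸ J)
    rw [ht, ← hcard] at h1
    exact_mod_cast h1
  have hrad : maximalIdeal (R ⧸ J) ≤ (Ideal.span (s : Set (R ⧸ J))).radical := by
    rw [Ideal.radical_eq_sInf]
    refine le_sInf ?_
    rintro p ⟨hp, hpp⟩
    exact hs.2 ⟨hpp, hp⟩ (le_maximalIdeal hpp.ne_top)
  obtain ⟨k, hk⟩ := Ideal.exists_pow_le_of_le_radical_of_fg hrad (IsNoetherian.noetherian _)
  have hsurj := Ideal.Quotient.mk_surjective (I := J)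
  refine ⟨s.toList.map (Function.surjInv hsurj), by simp [hst], ?_, k, ?_⟩
  · intro x hx
    obtain ⟨y, hy, rfl⟩ := List.mem_map.1 hx
    have hy : y ∈ maximalIdeal (R ⧸ J) := hs.1.2 (Ideal.subset_span (by simpa using hy))
    rw [← Function.surjInv_eq hsurj y] at hy
    rw [mem_maximalIdeal, mem_nonunits_iff] at hy ⊢
    exact fun h => hy (h.map _)
  · have h1 : maximalIdeal R ^ k ≤ Ideal.ofList (s.toList.map (Function.surjInv hsurj)) ⊔ J := by
      have h2 : (maximalIdeal R ^ k).map (Ideal.Quotient.mk J) ≤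
          (Ideal.ofList (s.toList.map (Function.surjInv hsurj))).map (Ideal.Quotient.mk J) := by
        rw [Ideal.map_pow, Ideal.map_ofList, List.map_map]
        have h3 : Ideal.ofList (List.map (Ideal.Quotient.mk J ∘ Function.surjInv hsurj) s.toList) =
            Ideal.span (s : Set (R ⧸ J)) := by
          have : (Ideal.Quotient.mk J ∘ Function.surjInv hsurj) = id :=
            funext (Function.surjInv_eq hsurj)
          rw [this, List.map_id, Ideal.ofList]
          congr 1
          ext
          simp
        rw [h3]
        refine le_trans (Ideal.pow_right_mono ?_ k) hk
        rw [Ideal.map_le_iff_le_comap]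
        intro x hx
        rw [Ideal.mem_comap, mem_maximalIdeal, mem_nonunits_iff]
        exact fun h => hx (isUnit_of_map_unit _ _ h)
      rw [Ideal.map_le_iff_le_comap] at h2
      refine h2.trans ?_
      rw [Ideal.comap_map_of_surjective _ hsurj]
      refine sup_le_sup_left ?_ _
      rw [← RingHom.ker_eq_comap_bot, Ideal.mk_ker]
    refine (Submodule.smul_mono_left h1).trans ?_
    rw [Submodule.sup_smul]
    refine sup_le le_rfl ?_
    exact (Submodule.annihilator_smul (⊤ : Submodule R A)).le.trans bot_le

lemma exists_pow_maximalIdeal_le {I : Ideal R} (hI : I.radical = maximalIdeal R) :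
    ∃ q, 0 < q ∧ maximalIdeal R ^ q ≤ I := by
  obtain ⟨q, hq⟩ := Ideal.exists_pow_le_of_le_radical_of_fg hI.ge (IsNoetherian.noetherian _)
  exact ⟨q + 1, by omega, (Ideal.pow_le_pow_right (by omega)).trans hq⟩

/-- The Hilbert function of a module of dimension `t` grows at most like a polynomial of
degree `t`. -/
lemma exists_length_quotient_le {I : Ideal R} (hI : I.radical = maximalIdeal R) (A : Type)
    [AddCommGroup A] [Module R A] [Module.Finite R A] {t : ℕ}
    (ht : mDim R A = ((t : ℕ∞) : WithBot ℕ∞)) :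
    ∃ L : ℕ, ∀ n : ℕ, Module.length R (A ⧸ I ^ (n + 1) • (⊤ : Submodule R A)) ≤
      ((L * (n + 1) ^ t : ℕ) : ℕ∞) := by
  obtain ⟨xs, rfl, hxs, hk⟩ := exists_system_of_parameters A ht
  obtain ⟨L, hL⟩ := exists_length_le xs A hxs hk
  obtain ⟨q, hq, hqI⟩ := exists_pow_maximalIdeal_le hI
  refine ⟨L * (q + 1) ^ xs.length, fun n => ?_⟩
  have h1 : maximalIdeal R ^ (q * (n + 1)) • (⊤ : Submodule R A) ≤
      I ^ (n + 1) • (⊤ : Submodule R A) := by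
    rw [pow_mul]
    exact Submodule.smul_mono_left (Ideal.pow_right_mono hqI _)
  refine (length_quotient_le_of_le h1).trans ((hL _).trans ?_)
  norm_cast
  rw [mul_assoc, ← mul_pow]
  gcongr
  nlinarith

/-- Hilbert coefficients in codegree above `dim A` agree along `0 → A → B → C → 0`. -/
lemma coeff_eq_of_exact {I : Ideal R} (hI : I.radical = maximalIdeal R)
    {A B C : Type} [AddCommGroup A] [Module R A] [AddCommGroup B] [Module R B]
    [AddCommGroup C] [Module R C] [Module.Finite R A]
    (f : A →ₗ[R] B) (g : B →ₗ[R] C) (hg : Function.Surjective g) (hfg : Function.Exact f g)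
    {t s : ℕ} (ht : mDim R A = ((t : ℕ∞) : WithBot ℕ∞)) {eB eC : ℕ → ℤ}
    (hB : HasHilbCoeffs R I B s eB) (hC : HasHilbCoeffs R I C s eC) (i : ℕ) (hi : i < s - t) :
    eB i = eC i := by
  obtain ⟨L, hL⟩ := exists_length_quotient_le hI A ht
  obtain ⟨N, l, hl⟩ := exists_hilbertFunction hB
  obtain ⟨N', l', hl'⟩ := exists_hilbertFunction hC
  have key : ∀ n ≥ max N N', |∑ j ∈ Finset.range (s + 1),
      ((-1) ^ (s - j) * eB (s - j) - (-1) ^ (s - j) * eC (s - j)) * ((n + j).choose j : ℤ)| ≤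
      (L : ℤ) * ((n : ℤ) + 1) ^ t := by
    intro n hn
    have h1 := hl n (le_of_max_le_left hn)
    have h2 := hl' n (le_of_max_le_right hn)
    simp only [sub_mul, Finset.sum_sub_distrib]
    rw [← h1.2, ← h2.2]
    have h3 := length_quotient_smul_top f g hg hfg (I ^ (n + 1))
    have h4 : Module.length R (A ⧸ (I ^ (n + 1) • (⊤ : Submodule R B)).comap f) ≤
        ((L * (n + 1) ^ t : ℕ) : ℕ∞) :=
      (length_quotient_le_of_le fun z hz => map_mem_smul_top f _ hz).trans (hL n)
    obtain ⟨u, hu⟩ := ENat.ne_top_iff_exists.1 (ne_top_of_le_ne_top (ENat.natCast_ne_top _) h4)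
    rw [← hu] at h3 h4
    rw [h1.1, h2.1] at h3
    norm_cast at h3 h4
    rw [h3]
    push_cast
    rw [add_sub_cancel_right, abs_of_nonneg (by positivity)]
    exact_mod_cast h4
  have := coeff_eq_zero _ t L _ s key (s - i) (by omega) (by omega)
  rw [show s - (s - i) = i by omega, ← mul_sub] at this
  have h5 : ((-1 : ℤ) ^ i) ≠ 0 := by positivity
  exact sub_eq_zero.1 ((mul_eq_zero.1 this).resolve_left h5)

end Growth

lemma ne_top_of_radical_eq {R : Type} [CommRing R] [IsLocalRing R] {I : Ideal R}
    (hI : I.radical = maximalIdeal R) : I ≠ ⊤ := by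
  rintro rfl
  rw [Ideal.radical_top] at hI
  exact Ideal.IsPrime.ne_top' hI.symm

lemma lsmul_mem_pow_succ_smul_top {R : Type} [CommRing R] {I : Ideal R} {M : Type}
    [AddCommGroup M] [Module R M] {n : ℕ} {h : R} (hh : h ∈ I) {z : M}
    (hz : z ∈ I ^ n • (⊤ : Submodule R M)) : h • z ∈ I ^ (n + 1) • (⊤ : Submodule R M) := by
  rw [pow_succ', Submodule.mul_smul]
  exact Submodule.smul_mem_smul hh hz

/-- The Artin–Rees lemma for multiplication by an element. -/
lemma exists_artinRees {R : Type} [CommRing R] [IsNoetherianRing R] (I : Ideal R) (M : Type)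
    [AddCommGroup M] [Module R M] [Module.Finite R M]
    (h : R) :
    ∃ k : ℕ, ∀ n ≥ k, ∀ z : M, h • z ∈ I ^ n • (⊤ : Submodule R M) →
      ∃ w ∈ I ^ (n - k) • (⊤ : Submodule R M), h • w = h • z := by
  obtain ⟨k, hk⟩ := Ideal.exists_pow_inf_eq_pow_smul I (LinearMap.range (LinearMap.lsmul R M h))
  refine ⟨k, fun n hn z hz => ?_⟩
  have h1 : h • z ∈ I ^ (n - k) • (LinearMap.range (LinearMap.lsmul R M h)) := by
    have : h • z ∈ I ^ n • (⊤ : Submodule R M) ⊓ LinearMap.range (LinearMap.lsmul R M h) :=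
      ⟨hz, z, rfl⟩
    rw [hk n hn] at this
    exact Submodule.smul_mono le_rfl inf_le_right this
  rw [LinearMap.range_eq_map, ← Submodule.map_smul''] at h1
  exact h1

lemma length_quotient_sup {R M : Type} [CommRing R] [AddCommGroup M] [Module R M]
    {K N : Submodule R M} (hKN : K ⊓ N = ⊥) :
    Module.length R (M ⧸ N) = Module.length R K + Module.length R (M ⧸ K ⊔ N) := by
  refine Module.length_eq_add_of_exact (N.mkQ ∘ₗ K.subtype) (Submodule.factor le_sup_right)
    ?_ (Submodule.factor_surjective le_sup_right) ?_
  · rw [injective_iff_map_eq_zero]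
    rintro ⟨z, hz⟩ h
    have h : z ∈ N := (Submodule.Quotient.mk_eq_zero _).1 h
    have : z ∈ K ⊓ N := ⟨hz, h⟩
    rw [hKN, Submodule.mem_bot] at this
    exact Subtype.ext this
  · intro z
    obtain ⟨z, rfl⟩ := Submodule.mkQ_surjective _ z
    constructor
    · intro h
      obtain ⟨u, hu, v, hv, rfl⟩ := Submodule.mem_sup.1 ((Submodule.Quotient.mk_eq_zero _).1 h)
      refine ⟨⟨u, hu⟩, ?_⟩
      change N.mkQ u = N.mkQ (u + v)
      rw [map_add, (Submodule.Quotient.mk_eq_zero N).2 hv |> (fun h => (h : N.mkQ v = 0)), add_zero]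
    · rintro ⟨u, hu⟩
      rw [← hu]
      exact (Submodule.Quotient.mk_eq_zero _).2 (Submodule.mem_sup_left u.2)

/-- The eventual form of the colon by a superficial element. -/
lemma exists_colon_eq {R : Type} [CommRing R] [IsNoetherianRing R] {I : Ideal R} {M : Type}
    [AddCommGroup M] [Module R M] [Module.Finite R M] {h : R} (hs : IsSuperficial R I M h) :
    ∃ N : ℕ, ∀ n ≥ N, (I ^ (n + 1) • (⊤ : Submodule R M)).comap (LinearMap.lsmul R M h) =
      LinearMap.ker (LinearMap.lsmul R M h) ⊔ I ^ n • (⊤ : Submodule R M) := by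
  obtain ⟨hh, c, N, hN⟩ := hs
  obtain ⟨k, hk⟩ := exists_artinRees I M h
  refine ⟨N + c + k, fun n hn => le_antisymm ?_ (sup_le ?_ ?_)⟩
  · intro z hz
    obtain ⟨w, hw, hwz⟩ := hk (n + 1) (by omega) z hz
    have hw' : w ∈ I ^ n • (⊤ : Submodule R M) := by
      rw [← hN n (by omega)]
      refine ⟨?_, Submodule.smul_mono_left (Ideal.pow_le_pow_right (by omega)) hw⟩
      change h • w ∈ I ^ (n + 1) • (⊤ : Submodule R M)
      rw [hwz]
      exact hz
    rw [← sub_add_cancel z w]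
    refine Submodule.add_mem_sup ?_ hw'
    rw [LinearMap.mem_ker, map_sub, LinearMap.lsmul_apply, LinearMap.lsmul_apply, hwz, sub_self]
  · intro z hz
    rw [Submodule.mem_comap, LinearMap.mem_ker.1 hz]
    exact zero_mem _
  · intro z hz
    exact lsmul_mem_pow_succ_smul_top hh hz

section Superficial

variable {R : Type} [CommRing R] [IsLocalRing R] [IsNoetherianRing R] {I : Ideal R}
  {M : Type} [AddCommGroup M] [Module R M] [Module.Finite R M]

lemma eq_zero_of_forall_mem_pow_smul (hI : I.radical = maximalIdeal R) {z : M} {N : ℕ}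
    (h : ∀ n ≥ N, z ∈ I ^ n • (⊤ : Submodule R M)) : z = 0 := by
  have h1 := Ideal.iInf_pow_smul_eq_bot_of_isLocalRing (M := M) I (ne_top_of_radical_eq hI)
  rw [← Submodule.mem_bot R, ← h1, Submodule.mem_iInf]
  intro i
  exact Submodule.smul_mono_left (Ideal.pow_le_pow_right (le_max_left i N))
    (h _ (le_max_right i N))

/-- A superficial element is injective on a deep power of the filtration. -/
lemma exists_superficial_injective (hI : I.radical = maximalIdeal R) {h : R}
    (hs : IsSuperficial R I M h) :
    ∃ c : ℕ, ∀ z ∈ I ^ c • (⊤ : Submodule R M), h • z = 0 → z = 0 := by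
  obtain ⟨-, c, N, hN⟩ := hs
  refine ⟨c, fun z hz hz0 => eq_zero_of_forall_mem_pow_smul hI (N := N) fun n hn => ?_⟩
  rw [← hN n hn, Submodule.mem_inf, Submodule.mem_comap, LinearMap.lsmul_apply, hz0]
  exact ⟨zero_mem _, hz⟩

lemma exists_length_eq_of_superficial (hI : I.radical = maximalIdeal R) {h : R}
    (hs : IsSuperficial R I M h) :
    ∃ N : ℕ, ∀ n ≥ N,
      Module.length R (M ⧸ I ^ (n + 1) • (⊤ : Submodule R M)) +
        Module.length R (LinearMap.ker (LinearMap.lsmul R M h)) =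
      Module.length R (M ⧸ I ^ n • (⊤ : Submodule R M)) +
        Module.length R ((M ⧸ Ideal.span {h} • (⊤ : Submodule R M)) ⧸
          I ^ (n + 1) • (⊤ : Submodule R (M ⧸ Ideal.span {h} • (⊤ : Submodule R M)))) := by
  obtain ⟨N, hN⟩ := exists_colon_eq hs
  obtain ⟨c, hc⟩ := exists_superficial_injective hI hs
  refine ⟨max N c, fun n hn => ?_⟩
  rw [length_quotient_smul_top (LinearMap.lsmul R M h) _ (Submodule.mkQ_surjective _)
    (exact_lsmul_mkQ h), hN n (le_of_max_le_left hn), length_quotient_sup (N := I ^ n • ⊤)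
    (K := LinearMap.ker (LinearMap.lsmul R M h)), add_comm _ (Module.length R _), add_assoc]
  · rw [eq_bot_iff]
    rintro z ⟨hz, hz'⟩
    exact hc z (Submodule.smul_mono_left (Ideal.pow_le_pow_right (le_of_max_le_right hn)) hz') hz

/-- The annihilator of a superficial element has finite length, and Hilbert coefficients descend
along a superficial element. -/
lemma coeff_superficial (hI : I.radical = maximalIdeal R) {r : ℕ} {h : R}
    (hs : IsSuperficial R I M h) {e e' : ℕ → ℤ}
    (he : HasHilbCoeffs R I M (r + 1) e)
    (he' : HasHilbCoeffs R I (M ⧸ Ideal.span {h} • (⊤ : Submodule R M)) r e') :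
    ∃ a : ℕ, Module.length R (LinearMap.ker (LinearMap.lsmul R M h)) = a ∧
      (∀ i < r, e i = e' i) ∧ e r = e' r + (-1) ^ (r + 1) * (a : ℤ) := by
  obtain ⟨N₀, hN₀⟩ := exists_length_eq_of_superficial hI hs
  obtain ⟨N, l, hl⟩ := exists_hilbertFunction he
  obtain ⟨N', l', hl'⟩ := exists_hilbertFunction he'
  have hfin : Module.length R (LinearMap.ker (LinearMap.lsmul R M h)) ≠ ⊤ := by
    have h1 := hN₀ (N₀ + N + N' + 1) (by omega)
    rw [(hl (N₀ + N + N') (by omega)).1, (hl' (N₀ + N + N' + 1) (by omega)).1] at h1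
    intro h2
    rw [h2, add_top] at h1
    exact absurd h1.symm (by norm_cast)
  obtain ⟨a, ha⟩ := ENat.ne_top_iff_exists.1 hfin
  have key : ∀ n ≥ N₀ + N + N' + 1, ∑ j ∈ Finset.range (r + 1),
      ((-1) ^ (r + 1 - (j + 1)) * e (r + 1 - (j + 1))) * ((n + j).choose j : ℤ) =
      ∑ j ∈ Finset.range (r + 1), ((-1) ^ (r - j) * e' (r - j)) * ((n + j).choose j : ℤ) +
        (-(a : ℤ)) := by
    intro n hn
    obtain ⟨n, rfl⟩ : ∃ m, n = m + 1 := ⟨n - 1, by omega⟩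
    have h1 := hl n (by omega)
    have h2 := hl (n + 1) (by omega)
    have h3 := hl' (n + 1) (by omega)
    have h4 := hN₀ (n + 1) (by omega)
    rw [h1.1, h2.1, h3.1, ← ha] at h4
    norm_cast at h4
    rw [← sum_choose_sub (fun j => (-1) ^ (r + 1 - j) * e (r + 1 - j)), ← h1.2, ← h2.2, ← h3.2]
    linarith
  obtain ⟨h1, h2⟩ := coeff_eq_of_sub_eq_const _ _ _ _ _ key
  refine ⟨a, ha.symm, fun i hi => ?_, ?_⟩
  · have := h1 (r - i) (by omega) (by omega)
    rw [show r + 1 - (r - i + 1) = i by omega, show r - (r - i) = i by omega] at this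
    exact mul_left_cancel₀ (by positivity) this
  · rw [show r + 1 - (0 + 1) = r by omega, Nat.sub_zero] at h2
    refine mul_left_cancel₀ (a := (-1 : ℤ) ^ r) (by positivity) ?_
    rw [h2, mul_add, ← mul_assoc, ← pow_add, show r + (r + 1) = 2 * r + 1 by ring]
    simp [pow_succ, pow_mul]

end Superficial

section Torsion

variable {R : Type} [CommRing R] [IsLocalRing R] [IsNoetherianRing R] {I : Ideal R}
  {M : Type} [AddCommGroup M] [Module R M]

lemma mem_powTorsion_maximalIdeal_iff (hI : I.radical = maximalIdeal R) {z : M} :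
    z ∈ powTorsion (maximalIdeal R) M ↔ ∃ n, ∀ r ∈ I ^ n, r • z = 0 := by
  have hIm : I ≤ maximalIdeal R := hI ▸ Ideal.le_radical
  obtain ⟨q, -, hq⟩ := exists_pow_maximalIdeal_le hI
  constructor
  · rintro ⟨n, hn⟩
    exact ⟨n, fun r hr => hn r (Ideal.pow_right_mono hIm n hr)⟩
  · rintro ⟨n, hn⟩
    refine ⟨q * n, fun r hr => hn r ?_⟩
    rw [pow_mul] at hr
    exact Ideal.pow_right_mono hq n hr

variable [Module.Finite R M]

/-- A uniform exponent annihilates the torsion submodule. -/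
lemma exists_pow_smul_powTorsion_eq_zero (hI : I.radical = maximalIdeal R) :
    ∃ k, ∀ z ∈ powTorsion (maximalIdeal R) M, ∀ r ∈ I ^ k, r • z = 0 := by
  obtain ⟨s, hs⟩ := (IsNoetherian.noetherian (powTorsion (maximalIdeal R) M) :
    (powTorsion (maximalIdeal R) M).FG)
  have h1 : ∀ z : M, ∃ n, z ∈ s → ∀ r ∈ I ^ n, r • z = 0 := by
    intro z
    by_cases hz : z ∈ s
    · obtain ⟨n, hn⟩ := (mem_powTorsion_maximalIdeal_iff hI).1
        (hs ▸ Submodule.subset_span hz : z ∈ powTorsion (maximalIdeal R) M)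
      exact ⟨n, fun _ => hn⟩
    · exact ⟨0, fun h => absurd h hz⟩
  choose n hn using h1
  refine ⟨s.sup n, fun z hz r hr => ?_⟩
  have h2 : powTorsion (maximalIdeal R) M ≤ LinearMap.ker (LinearMap.lsmul R M r) := by
    rw [← hs, Submodule.span_le]
    intro x hx
    exact hn x hx r (Ideal.pow_le_pow_right (Finset.le_sup (f := n) hx) hr)
  exact h2 hz

lemma exists_powTorsion_inf_eq_bot (hI : I.radical = maximalIdeal R) (M : Type) [AddCommGroup M]
    [Module R M] [Module.Finite R M] :
    ∃ k, ∀ n ≥ k, I ^ n • (⊤ : Submodule R M) ⊓ powTorsion (maximalIdeal R) M = ⊥ := by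
  obtain ⟨k, hk⟩ := exists_pow_smul_powTorsion_eq_zero (M := M) hI
  obtain ⟨j, hj⟩ := Ideal.exists_pow_inf_eq_pow_smul I (powTorsion (maximalIdeal R) M)
  refine ⟨j + k, fun n hn => ?_⟩
  rw [hj n (by omega), eq_bot_iff, Submodule.smul_le]
  rintro r hr z ⟨-, hz⟩
  exact hk z hz r (Ideal.pow_le_pow_right (by omega) hr)

/-- The first Hilbert coefficient of a module on which `I` acts as a principal ideal. -/
lemma coeff_one_eq_neg_length (hI : I.radical = maximalIdeal R) {e : ℕ → ℤ}
    (he : HasHilbCoeffs R I M 1 e) {y : R} (hy : y ∈ I)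
    (hIy : ∀ a ∈ I, ∃ b, ∀ z : M, a • z = (b * y) • z) :
    ∃ w : ℕ, Module.length R (powTorsion (maximalIdeal R) M) = w ∧ e 1 = -(w : ℤ) := by
  set W := powTorsion (maximalIdeal R) M with hW
  have hreg : ∀ z : M ⧸ W, y • z = 0 → z = 0 := by
    intro z hz
    obtain ⟨z, rfl⟩ := Submodule.mkQ_surjective _ z
    rw [← map_smul] at hz
    have hz : y • z ∈ W := (Submodule.Quotient.mk_eq_zero _).1 hz
    refine (Submodule.Quotient.mk_eq_zero _).2 ?_
    rw [hW, mem_powTorsion_maximalIdeal_iff hI] at hz ⊢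
    obtain ⟨n, hn⟩ := hz
    refine ⟨n + 1, fun r hr => ?_⟩
    have h1 : I ^ (n + 1) ≤ (Submodule.span R {z}).annihilator := by
      rw [pow_succ]
      refine Ideal.mul_le.2 fun r hr a ha => ?_
      rw [Submodule.mem_annihilator_span_singleton]
      obtain ⟨b, hb⟩ := hIy a ha
      rw [mul_smul, hb, mul_smul, smul_comm, hn r hr, smul_zero]
    exact (Submodule.mem_annihilator_span_singleton _ _).1 (h1 hr)
  have hIN : I • (⊤ : Submodule R (M ⧸ W)) ≤ Ideal.span {y} • ⊤ := by
    refine Submodule.smul_le.2 fun a ha z _ => ?_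
    obtain ⟨z, rfl⟩ := Submodule.mkQ_surjective _ z
    obtain ⟨b, hb⟩ := hIy a ha
    rw [mem_span_singleton_smul_top]
    exact ⟨W.mkQ (b • z), by rw [← map_smul, ← map_smul, hb, smul_smul, mul_comm]⟩
  have hcolon : ∀ n, (I ^ (n + 1) • (⊤ : Submodule R (M ⧸ W))).comap
      (LinearMap.lsmul R (M ⧸ W) y) = I ^ n • (⊤ : Submodule R (M ⧸ W)) := by
    intro n
    refine le_antisymm (fun z hz => ?_) fun z hz => lsmul_mem_pow_succ_smul_top hy hz
    have h1 : I ^ (n + 1) • (⊤ : Submodule R (M ⧸ W)) ≤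
        (I ^ n • (⊤ : Submodule R (M ⧸ W))).map (LinearMap.lsmul R (M ⧸ W) y) := by
      rw [pow_succ, Submodule.mul_smul, Submodule.map_smul'']
      refine Submodule.smul_mono le_rfl (hIN.trans fun z hz => ?_)
      obtain ⟨w, hw⟩ := (mem_span_singleton_smul_top _ _).1 hz
      exact ⟨w, trivial, hw⟩
    obtain ⟨w, hw, hwz⟩ := h1 hz
    have h2 : y • (z - w) = 0 := by rw [smul_sub, sub_eq_zero]; exact hwz.symm
    rw [sub_eq_zero.1 (hreg _ h2)]
    exact hw
  have hzero : ∀ n, I ^ (n + 1) • (⊤ : Submodule R ((M ⧸ W) ⧸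
      Ideal.span {y} • (⊤ : Submodule R (M ⧸ W)))) = ⊥ := by
    intro n
    rw [eq_bot_iff]
    intro z hz
    obtain ⟨z, rfl⟩ := Submodule.mkQ_surjective _ z
    rw [mkQ_mem_smul_top_iff] at hz
    have h1 : Ideal.span {y} • (⊤ : Submodule R (M ⧸ W)) ⊔ I ^ (n + 1) • ⊤ ≤
        Ideal.span {y} • (⊤ : Submodule R (M ⧸ W)) :=
      sup_le le_rfl ((Submodule.smul_mono_left (Ideal.pow_le_self (by omega))).trans hIN)
    exact (Submodule.Quotient.mk_eq_zero _).2 (h1 hz)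
  set γ := Module.length R ((M ⧸ W) ⧸ Ideal.span {y} • (⊤ : Submodule R (M ⧸ W))) with hγ
  have hN : ∀ n : ℕ, Module.length R ((M ⧸ W) ⧸ I ^ n • (⊤ : Submodule R (M ⧸ W))) = n * γ := by
    intro n
    induction n with
    | zero =>
      have : Subsingleton ((M ⧸ W) ⧸ I ^ 0 • (⊤ : Submodule R (M ⧸ W))) := by
        rw [Submodule.Quotient.subsingleton_iff]
        simp
      rw [Module.length_eq_zero]
      simp
    | succ n ih =>
      rw [length_quotient_smul_top (LinearMap.lsmul R (M ⧸ W) y) _ (Submodule.mkQ_surjective _)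
        (exact_lsmul_mkQ y), hcolon, ih, hzero,
        LinearEquiv.length_eq (Submodule.quotEquivOfEqBot _ rfl), ← hγ]
      push_cast
      ring
  obtain ⟨k, hk⟩ := exists_powTorsion_inf_eq_bot hI M
  obtain ⟨N, l, hl⟩ := exists_hilbertFunction he
  have key : ∀ n ≥ N + k, (l n : ℕ∞) = Module.length R W + ((n + 1 : ℕ) : ℕ∞) * γ := by
    intro n hn
    have h1 : (I ^ (n + 1) • (⊤ : Submodule R M)).comap W.subtype = ⊥ := by
      rw [eq_bot_iff]
      intro z hz
      have h2 : (z : M) ∈ I ^ (n + 1) • (⊤ : Submodule R M) ⊓ W := ⟨hz, z.2⟩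
      rw [hk (n + 1) (by omega)] at h2
      exact Subtype.ext h2
    rw [← (hl n (by omega)).1, length_quotient_smul_top W.subtype _ (Submodule.mkQ_surjective _)
      (exact_subtype_mkQ W), hN, h1, LinearEquiv.length_eq (Submodule.quotEquivOfEqBot _ rfl)]
  have h1 := key (N + k) le_rfl
  have h2 := key (N + k + 1) (by omega)
  have hw : Module.length R W ≠ ⊤ := by
    intro h
    rw [h, top_add] at h1
    exact ENat.natCast_ne_top _ h1
  have hγ' : γ ≠ ⊤ := by
    intro h
    rw [h, ENat.mul_top (by norm_cast), add_top] at h1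
    exact ENat.natCast_ne_top _ h1
  obtain ⟨w, hw⟩ := ENat.ne_top_iff_exists.1 hw
  obtain ⟨g, hg⟩ := ENat.ne_top_iff_exists.1 hγ'
  refine ⟨w, hw.symm, ?_⟩
  rw [← hw, ← hg] at h1 h2
  norm_cast at h1 h2
  have h3 := (hl (N + k) (by omega)).2
  have h4 := (hl (N + k + 1) (by omega)).2
  rw [h1] at h3
  rw [h2] at h4
  simp [Finset.sum_range_succ] at h3 h4
  have h5 : e 0 = g := by linarith
  rw [h5] at h3
  linarith

end Torsion

/-- Dividing by `h` inside a submodule `P` on which `h` is injective. -/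
noncomputable def divHom {R : Type} [CommRing R] {M : Type} [AddCommGroup M] [Module R M]
    {h : R} {P V : Submodule R M} {J : Ideal R}
    (hP : Function.Injective (LinearMap.lsmul R M h ∘ₗ P.subtype))
    (hV : ∀ z : V, ∀ r : J,
      (r : R) • (z : M) ∈ LinearMap.range (LinearMap.lsmul R M h ∘ₗ P.subtype)) :
    V →ₗ[R] J →ₗ[R] M :=
  LinearMap.mk₂ R (fun z r => P.subtype ((LinearEquiv.ofInjective _ hP).symm ⟨_, hV z r⟩))
    (fun a b r => by
      rw [← map_add, ← map_add]
      congr 2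
      exact Subtype.ext (smul_add _ _ _))
    (fun c a r => by
      rw [← map_smul, ← map_smul]
      congr 2
      exact Subtype.ext (smul_comm _ _ _))
    (fun a r s => by
      rw [← map_add, ← map_add]
      congr 2
      exact Subtype.ext (add_smul _ _ _))
    (fun c a r => by
      rw [← map_smul, ← map_smul]
      congr 2
      exact Subtype.ext (mul_smul _ _ _))

lemma divHom_mem {R : Type} [CommRing R] {M : Type} [AddCommGroup M] [Module R M]
    {h : R} {P V : Submodule R M} {J : Ideal R}
    (hP : Function.Injective (LinearMap.lsmul R M h ∘ₗ P.subtype))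
    (hV : ∀ z : V, ∀ r : J,
      (r : R) • (z : M) ∈ LinearMap.range (LinearMap.lsmul R M h ∘ₗ P.subtype)) (z : V) (r : J) :
    divHom hP hV z r ∈ P :=
  Subtype.prop _

lemma smul_divHom {R : Type} [CommRing R] {M : Type} [AddCommGroup M] [Module R M]
    {h : R} {P V : Submodule R M} {J : Ideal R}
    (hP : Function.Injective (LinearMap.lsmul R M h ∘ₗ P.subtype))
    (hV : ∀ z : V, ∀ r : J,
      (r : R) • (z : M) ∈ LinearMap.range (LinearMap.lsmul R M h ∘ₗ P.subtype)) (z : V) (r : J) :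
    h • divHom hP hV z r = (r : R) • (z : M) :=
  congrArg Subtype.val ((LinearEquiv.ofInjective _ hP).apply_symm_apply ⟨_, hV z r⟩)

lemma length_eq_ker_add_range {R A B : Type} [CommRing R] [AddCommGroup A] [Module R A]
    [AddCommGroup B] [Module R B] (f : A →ₗ[R] B) :
    Module.length R A =
      Module.length R (LinearMap.ker f) + Module.length R (LinearMap.range f) := by
  rw [← f.quotKerEquivRange.length_eq]
  exact Module.length_eq_add_of_exact _ _ (Submodule.subtype_injective _)
    (Submodule.mkQ_surjective _) (exact_subtype_mkQ _)

lemma length_eq_add_of_ker_le {R V T X : Type} [CommRing R] [AddCommGroup V] [Module R V]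
    [AddCommGroup T] [Module R T] [AddCommGroup X] [Module R X] {π : V →ₗ[R] T} {Ψ : V →ₗ[R] X}
    (hπ : Function.Surjective π) (hΨ : Function.Surjective Ψ)
    (hle : LinearMap.ker π ≤ LinearMap.ker Ψ) :
    Module.length R T = Module.length R ((LinearMap.ker Ψ).map π) + Module.length R X := by
  let θ : T →ₗ[R] X := (LinearMap.ker π).liftQ Ψ hle ∘ₗ (π.quotKerEquivOfSurjective hπ).symm
  have hθ : ∀ v, θ (π v) = Ψ v := by
    intro v
    have : (π.quotKerEquivOfSurjective hπ).symm (π v) = Submodule.Quotient.mk v := by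
      rw [LinearEquiv.symm_apply_eq]
      rfl
    change (LinearMap.ker π).liftQ Ψ hle ((π.quotKerEquivOfSurjective hπ).symm (π v)) = _
    rw [this]
    rfl
  refine Module.length_eq_add_of_exact ((LinearMap.ker Ψ).map π).subtype θ
    (Submodule.subtype_injective _) (fun x => ?_) (fun t => ?_)
  · obtain ⟨v, rfl⟩ := hΨ x
    exact ⟨π v, hθ v⟩
  · obtain ⟨v, rfl⟩ := hπ t
    rw [hθ]
    constructor
    · intro hv
      exact ⟨⟨π v, v, hv, rfl⟩, rfl⟩
    · rintro ⟨⟨_, w, hw, rfl⟩, hwv⟩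
      rw [← hθ, ← hwv]
      exact (hθ w).trans hw

section LocalCohomology

variable {R : Type} [CommRing R] [IsLocalRing R] [IsNoetherianRing R]
  {M : Type} [AddCommGroup M] [Module R M] [Module.Finite R M]

/-- The connecting map onto the kernel of `h` on `H¹_𝔪(M)`. -/
lemma exists_connecting {h : R} {P : Submodule R M} (hP : ∀ z ∈ P, h • z = 0 → z = 0) {q : ℕ}
    (hq : maximalIdeal R ^ q • ⊤ ≤ P) :
    ∃ Ψ : (powTorsion (maximalIdeal R) (M ⧸ Ideal.span {h} • (⊤ : Submodule R M))).comap
        (Ideal.span {h} • (⊤ : Submodule R M)).mkQ →ₗ[R]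
        LinearMap.ker (LinearMap.lsmul R (LC R 1 M) h),
      Function.Surjective Ψ ∧ ∀ z, Ψ z = 0 ↔
        ∃ u : M, (z : M) - h • u ∈ powTorsion (maximalIdeal R) M := by
  have hmm : (maximalIdeal R).radical = maximalIdeal R := (maximalIdeal.isMaximal R).isPrime.radical
  set H := Ideal.span {h} • (⊤ : Submodule R M) with hH
  set T := powTorsion (maximalIdeal R) (M ⧸ H) with hT
  obtain ⟨k₀, hk₀⟩ := exists_pow_smul_powTorsion_eq_zero (M := M ⧸ H) hmm
  obtain ⟨k₁, hk₁⟩ := exists_artinRees (maximalIdeal R) M h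
  have hPinj : Function.Injective (LinearMap.lsmul R M h ∘ₗ P.subtype) := by
    rw [injective_iff_map_eq_zero]
    exact fun z hz => Subtype.ext (hP z z.2 hz)
  have hPeq : ∀ a ∈ P, ∀ b ∈ P, h • a = h • b → a = b := fun a ha b hb hab =>
    sub_eq_zero.1 (hP _ (sub_mem ha hb) (by rw [smul_sub, hab, sub_self]))
  set k := max k₀ (k₁ + q) with hk
  have hV : ∀ z : T.comap H.mkQ, ∀ r : ↥(maximalIdeal R ^ k),
      (r : R) • (z : M) ∈ LinearMap.range (LinearMap.lsmul R M h ∘ₗ P.subtype) := by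
    rintro ⟨z, hz⟩ ⟨r, hr⟩
    have h1 : r • z ∈ H := by
      rw [← Submodule.Quotient.mk_eq_zero, Submodule.Quotient.mk_smul]
      exact hk₀ _ hz r (Ideal.pow_le_pow_right (by omega) hr)
    obtain ⟨u, hu⟩ := (mem_span_singleton_smul_top _ _).1 h1
    have h2 : h • u ∈ maximalIdeal R ^ (k₁ + q) • (⊤ : Submodule R M) := by
      rw [hu]
      exact Submodule.smul_mem_smul (Ideal.pow_le_pow_right (by omega) hr) trivial
    obtain ⟨w, hw, hwu⟩ := hk₁ (k₁ + q) (by omega) u h2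
    rw [Nat.add_sub_cancel_left] at hw
    exact ⟨⟨w, hq hw⟩, hwu.trans hu⟩
  set D := divHom hPinj hV with hD
  have hker : ∀ z, (lcOne (maximalIdeal R) M k ∘ₗ D) z ∈
      LinearMap.ker (LinearMap.lsmul R (LC R 1 M) h) := by
    intro z
    change h • lcOne (maximalIdeal R) M k (D z) = 0
    rw [← map_smul, lcOne_eq_zero_iff]
    exact ⟨k, le_rfl, z, fun r => smul_divHom hPinj hV z r⟩
  refine ⟨LinearMap.codRestrict _ (lcOne (maximalIdeal R) M k ∘ₗ D) hker, ?_, ?_⟩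
  · rintro ⟨x, hx⟩
    obtain ⟨n, φ, rfl⟩ := exists_lcOne (maximalIdeal R) M x
    have hx : h • lcOne (maximalIdeal R) M n φ = 0 := hx
    rw [← map_smul, lcOne_eq_zero_iff] at hx
    obtain ⟨k', hk', z, hz⟩ := hx
    have hzV : z ∈ T.comap H.mkQ := by
      refine ⟨k', fun r hr => ?_⟩
      rw [← map_smul, ← hz ⟨r, hr⟩]
      exact (Submodule.Quotient.mk_eq_zero _).2 ((mem_span_singleton_smul_top _ _).2 ⟨_, rfl⟩)
    refine ⟨⟨z, hzV⟩, Subtype.ext ?_⟩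
    change lcOne (maximalIdeal R) M k (D ⟨z, hzV⟩) = lcOne (maximalIdeal R) M n φ
    have hnK : n ≤ max (q + n) (max k' k) := by omega
    have hkK : k ≤ max (q + n) (max k' k) := by omega
    have hkK' : k' ≤ max (q + n) (max k' k) := by omega
    rw [← lcOne_restrict _ hnK, ← lcOne_restrict _ hkK]
    congr 1
    ext r
    refine hPeq _ (divHom_mem hPinj hV _ _) _ ?_ ((smul_divHom hPinj hV _ _).trans
      (hz ⟨r, Ideal.pow_le_pow_right hkK' r.2⟩).symm)
    have h3 : maximalIdeal R ^ q * maximalIdeal R ^ n ≤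
        (P.comap φ).map (maximalIdeal R ^ n).subtype := by
      refine Ideal.mul_le.2 fun a ha b hb => ⟨⟨a * b, Ideal.mul_mem_left _ _ hb⟩, ?_, rfl⟩
      change φ (a • ⟨b, hb⟩) ∈ P
      rw [map_smul]
      exact hq (Submodule.smul_mem_smul ha trivial)
    rw [← pow_add] at h3
    obtain ⟨s, hs, hsr⟩ := h3 (Ideal.pow_le_pow_right (le_max_left _ _) r.2)
    have : Submodule.inclusion (Ideal.pow_le_pow_right hnK) r = s := Subtype.ext hsr.symm
    rw [LinearMap.comp_apply, this]
    exact hs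
  · intro z
    rw [← Subtype.coe_inj]
    change lcOne (maximalIdeal R) M k (D z) = 0 ↔ _
    rw [lcOne_eq_zero_iff]
    constructor
    · rintro ⟨K, hK, u, hu⟩
      refine ⟨u, K, fun r hr => ?_⟩
      rw [smul_sub, smul_comm r h u, ← hu ⟨r, hr⟩, sub_eq_zero]
      exact (smul_divHom hPinj hV z ⟨r, Ideal.pow_le_pow_right hK hr⟩).symm
    · rintro ⟨u, K, hu⟩
      refine ⟨max K (max k q), by omega, u, fun r => ?_⟩
      refine hPeq _ (divHom_mem hPinj hV _ _) _
        (hq (Submodule.smul_mem_smul (Ideal.pow_le_pow_right (by omega) r.2) trivial)) ?_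
      refine (smul_divHom hPinj hV _ _).trans ?_
      have h1 := hu r (Ideal.pow_le_pow_right (by omega) r.2)
      rw [smul_sub, sub_eq_zero] at h1
      exact h1.trans (smul_comm _ _ _)

/-- The torsion of `M / hM` measures the kernel of `h` on `M` and on `H¹_𝔪(M)`. -/
lemma length_powTorsion_quotient {h : R} {P : Submodule R M}
    (hP : ∀ z ∈ P, h • z = 0 → z = 0) {q : ℕ} (hq : maximalIdeal R ^ q • ⊤ ≤ P) :
    Module.length R (powTorsion (maximalIdeal R) (M ⧸ Ideal.span {h} • (⊤ : Submodule R M))) =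
      Module.length R (LinearMap.ker (LinearMap.lsmul R M h)) +
        Module.length R (LinearMap.ker (LinearMap.lsmul R (LC R 1 M) h)) := by
  have hmm : (maximalIdeal R).radical = maximalIdeal R := (maximalIdeal.isMaximal R).isPrime.radical
  set H := Ideal.span {h} • (⊤ : Submodule R M) with hH
  set T := powTorsion (maximalIdeal R) (M ⧸ H) with hT
  set G := powTorsion (maximalIdeal R) M with hG
  obtain ⟨Ψ, hΨ, hΨ0⟩ := exists_connecting hP hq
  have hkerG : LinearMap.ker (LinearMap.lsmul R M h) ≤ G := by
    intro z hz
    have hz : h • z = 0 := hz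
    refine ⟨q, fun r hr => hP _ (hq (Submodule.smul_mem_smul hr trivial)) ?_⟩
    rw [smul_comm, hz, smul_zero]
  let π : T.comap H.mkQ →ₗ[R] T := H.mkQ.restrict fun _ hz => hz
  have hπ : Function.Surjective π := by
    rintro ⟨t, ht⟩
    obtain ⟨z, rfl⟩ := Submodule.mkQ_surjective _ t
    exact ⟨⟨z, ht⟩, rfl⟩
  have hπ0 : ∀ z, π z = 0 ↔ (z : M) ∈ H := by
    intro z
    rw [← Subtype.coe_inj]
    exact Submodule.Quotient.mk_eq_zero _
  have hGT : ∀ z ∈ G, z ∈ T.comap H.mkQ := by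
    rintro z ⟨n, hn⟩
    exact ⟨n, fun r hr => by rw [← map_smul, hn r hr, map_zero]⟩
  have hle : LinearMap.ker π ≤ LinearMap.ker Ψ := by
    intro z hz
    obtain ⟨u, hu⟩ := (mem_span_singleton_smul_top _ _).1 ((hπ0 z).1 hz)
    rw [LinearMap.mem_ker, hΨ0]
    exact ⟨u, by rw [hu, sub_self]; exact zero_mem _⟩
  rw [length_eq_add_of_ker_le hπ hΨ hle]
  congr 1
  let δ : G →ₗ[R] T := π ∘ₗ Submodule.inclusion hGT
  have hrange : (LinearMap.ker Ψ).map π = LinearMap.range δ := by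
    ext t
    constructor
    · rintro ⟨z, hz, rfl⟩
      obtain ⟨u, hu⟩ := (hΨ0 z).1 hz
      refine ⟨⟨_, hu⟩, ?_⟩
      rw [← sub_eq_zero]
      change π _ - π z = 0
      rw [← map_sub, hπ0]
      refine (mem_span_singleton_smul_top _ _).2 ⟨-u, ?_⟩
      change _ = ((z : M) - h • u) - z
      rw [smul_neg]
      abel
    · rintro ⟨z, rfl⟩
      refine ⟨Submodule.inclusion hGT z, (hΨ0 _).2 ⟨0, ?_⟩, rfl⟩
      rw [smul_zero, sub_zero]
      exact z.2
  have hkerδ : LinearMap.ker δ = LinearMap.range (LinearMap.lsmul R G h) := by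
    ext z
    change π _ = 0 ↔ _
    rw [hπ0, mem_span_singleton_smul_top]
    constructor
    · rintro ⟨w, hw⟩
      have hw : h • w = z := hw
      have hwG : w ∈ G := by
        obtain ⟨n, hn⟩ := z.2
        refine ⟨q + n, ?_⟩
        have h1 : maximalIdeal R ^ (q + n) ≤ (Submodule.span R {w}).annihilator := by
          rw [pow_add]
          refine Ideal.mul_le.2 fun a ha b hb => ?_
          rw [Submodule.mem_annihilator_span_singleton, mul_smul]
          refine hP _ (hq (Submodule.smul_mem_smul ha trivial)) ?_
          rw [smul_comm, smul_comm h b, hw, hn b hb, smul_zero]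
        exact fun r hr => (Submodule.mem_annihilator_span_singleton _ _).1 (h1 hr)
      exact ⟨⟨w, hwG⟩, Subtype.ext hw⟩
    · rintro ⟨w, rfl⟩
      exact ⟨w, rfl⟩
  have hfinG : Module.length R G ≠ ⊤ := by
    obtain ⟨k, hk⟩ := exists_pow_smul_powTorsion_eq_zero (M := M) hmm
    have : maximalIdeal R ^ k • (⊤ : Submodule R G) = ⊥ := by
      rw [eq_bot_iff, Submodule.smul_le]
      exact fun r hr z _ => Subtype.ext (hk z z.2 r hr)
    exact Module.length_ne_top_iff.2 (isFiniteLength_of_pow_smul_eq_bot this)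
  have e1 := length_eq_ker_add_range δ
  have e2 := length_eq_ker_add_range (LinearMap.lsmul R G h)
  have e3 : Module.length R (LinearMap.ker (LinearMap.lsmul R G h)) =
      Module.length R (LinearMap.ker (LinearMap.lsmul R M h)) := by
    refine LinearEquiv.length_eq
      (LinearEquiv.ofBijective (G.subtype.restrict (fun z hz => ?_)) ⟨?_, ?_⟩)
    · exact congrArg Subtype.val (show h • z = 0 from hz)
    · intro a b hab
      exact Subtype.ext (Subtype.ext
        (congrArg (LinearMap.ker (LinearMap.lsmul R M h)).subtype hab))
    · rintro ⟨z, hz⟩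
      exact ⟨⟨⟨z, hkerG hz⟩, Subtype.ext hz⟩, rfl⟩
  rw [hrange, ← e3]
  rw [e1, hkerδ, add_comm] at e2
  rw [e1, hkerδ] at hfinG
  exact (ENat.add_left_injective_of_ne_top (fun hh => hfinG (by rw [hh, top_add]))) e2

end LocalCohomology

/-- A superficial element is a minimal generator in positive dimension. -/
lemma notMem_maximalIdeal_mul_of_superficial {R : Type} [CommRing R] [IsLocalRing R]
    [IsNoetherianRing R] {I : Ideal R} {M : Type} [AddCommGroup M] [Module R M]
    [Module.Finite R M] (hI : I.radical = maximalIdeal R) {h : R}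
    (hs : IsSuperficial R I M h) (hM : 0 < mDim R M) : h ∉ maximalIdeal R * I := by
  intro hh
  obtain ⟨-, c, N, hN⟩ := hs
  obtain ⟨q, -, hq⟩ := exists_pow_maximalIdeal_le hI
  have hhq : h ^ q ∈ I ^ (q + 1) := by
    have h1 := Ideal.pow_mem_pow hh q
    rw [mul_pow] at h1
    rw [pow_succ']
    exact Ideal.mul_mono_left hq h1
  set n := max c N with hn
  have hstep : ∀ j, ∀ z ∈ I ^ n • (⊤ : Submodule R M),
      h ^ j • z ∈ I ^ (n + 1 + j) • (⊤ : Submodule R M) →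
      z ∈ I ^ (n + 1) • (⊤ : Submodule R M) := by
    intro j
    induction j with
    | zero => exact fun z _ hz => by simpa using hz
    | succ j ih =>
      intro z hzn hz
      refine ih z hzn ?_
      rw [← hN (n + 1 + j) (by omega)]
      refine ⟨?_, ?_⟩
      · change h • h ^ j • z ∈ I ^ (n + 1 + j + 1) • (⊤ : Submodule R M)
        rw [smul_smul, ← pow_succ']
        exact hz
      · exact Submodule.smul_mem _ _
          (Submodule.smul_mono_left (Ideal.pow_le_pow_right (le_max_left _ _)) hzn)
  have hle : I ^ n • (⊤ : Submodule R M) ≤ I • I ^ n • (⊤ : Submodule R M) := by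
    intro z hz
    rw [← Submodule.mul_smul, ← pow_succ']
    refine hstep q z hz ?_
    have h1 := Submodule.smul_mem_smul hhq hz
    rw [← Submodule.mul_smul, ← pow_add] at h1
    rwa [show n + 1 + q = q + 1 + n by ring]
  have hbot : I ^ n • (⊤ : Submodule R M) = ⊥ :=
    Submodule.eq_bot_of_le_smul_of_le_jacobson_bot I _ (IsNoetherian.noetherian _) hle
      ((le_maximalIdeal (ne_top_of_radical_eq hI)).trans (maximalIdeal_le_jacobson _))
  have hann : maximalIdeal R ^ (q * n) ≤ (⊤ : Submodule R M).annihilator := by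
    rw [pow_mul]
    refine (Ideal.pow_right_mono hq n).trans ?_
    intro r hr
    rw [Submodule.mem_annihilator]
    intro z hz
    rw [← Submodule.mem_bot R, ← hbot]
    exact Submodule.smul_mem_smul hr hz
  have := isArtinianRing_quotient_of_pow_le hann
  have h1 : Ring.KrullDimLE 0 (R ⧸ (⊤ : Submodule R M).annihilator) := inferInstance
  have h2 : mDim R M ≤ 0 := by
    exact (Order.krullDimLE_iff _ _).1 h1
  exact absurd hM (not_lt.2 h2)


/-- An element outside `𝔪 I` is part of a minimal system of generators. -/
lemma exists_complement {R : Type} [CommRing R] [IsLocalRing R] {I : Ideal R} {x : Fin 2 → R}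
    (hI : I = Ideal.span (Set.range x)) {h : R} (hh : h ∈ I) (hh' : h ∉ maximalIdeal R * I) : ∃ y ∈ I, ∀ a ∈ I, ∃ c b, a = c * h + b * y := by
  have hx : ∀ i, x i ∈ I := fun i => hI ▸ Ideal.subset_span ⟨i, rfl⟩
  have hmem : ∀ a ∈ I, ∃ c b, a = c * x 0 + b * x 1 := by
    intro a ha
    rw [hI, Ideal.mem_span_range_iff_exists_fun] at ha
    obtain ⟨c, rfl⟩ := ha
    exact ⟨c 0, c 1, by simp [Fin.sum_univ_two]⟩
  obtain ⟨u, v, huv⟩ := hmem h hh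
  by_cases hu : IsUnit u
  · obtain ⟨u', hu'⟩ := hu.exists_left_inv
    refine ⟨x 1, hx 1, fun a ha => ?_⟩
    obtain ⟨c, b, rfl⟩ := hmem a ha
    refine ⟨c * u', b - c * u' * v, ?_⟩
    rw [huv]
    linear_combination (-c * x 0) * hu'
  by_cases hv : IsUnit v
  · obtain ⟨v', hv'⟩ := hv.exists_left_inv
    refine ⟨x 0, hx 0, fun a ha => ?_⟩
    obtain ⟨c, b, rfl⟩ := hmem a ha
    refine ⟨b * v', c - b * v' * u, ?_⟩
    rw [huv]
    linear_combination (-b * x 1) * hv'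
  · refine absurd ?_ hh'
    rw [huv]
    exact add_mem (Ideal.mul_mem_mul ((mem_maximalIdeal _).2 hu) (hx 0))
      (Ideal.mul_mem_mul ((mem_maximalIdeal _).2 hv) (hx 1))

lemma mLength_LC_zero {R : Type} [CommRing R] [IsLocalRing R] (M : Type) [AddCommGroup M]
    [Module R M] (l : ℕ) : mLength R (LC R 0 M) = ((l : ℕ∞) : WithBot ℕ∞) ↔
      Module.length R (powTorsion (maximalIdeal R) M) = l := by
  rw [mLength_eq_iff, (powTorsionEquiv (maximalIdeal R) M).length_eq]
  rfl

end HilbertCoeff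

open HilbertCoeff

theorem statement1 (R : Type) [CommRing R] [IsLocalRing R] [IsNoetherianRing R]
    (I : Ideal R) (hI : I.radical = maximalIdeal R) :
    -- (a)
    (∀ (M : Type) [AddCommGroup M] [Module R M] [Module.Finite R M] (r : ℕ),
      mDim R M = (r : ℕ∞) → 0 < r → ∀ h : R, IsSuperficial R I M h →
      ∀ e e' : ℕ → ℤ, HasHilbCoeffs R I M r e →
        HasHilbCoeffs R I (M ⧸ Ideal.span {h} • (⊤ : Submodule R M)) (r - 1) e' →
      ∀ a : ℕ, mLength R ↥(LinearMap.ker (LinearMap.lsmul R M h)) = (a : ℕ∞) →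
        (∀ i < r - 1, e i = e' i) ∧
          e (r - 1) = e' (r - 1) + (-1 : ℤ) ^ r * (a : ℤ)) ∧
    -- (b)
    (∀ (A B C : Type) [AddCommGroup A] [Module R A] [AddCommGroup B] [Module R B]
        [AddCommGroup C] [Module R C]
        [Module.Finite R A] [Module.Finite R B] [Module.Finite R C]
        (f : A →ₗ[R] B) (g : B →ₗ[R] C),
      Function.Injective f → Function.Surjective g → Function.Exact f g →
      ∀ t s : ℕ, mDim R A = (t : ℕ∞) → mDim R B = (s : ℕ∞) → t < s →
      ∀ eB eC : ℕ → ℤ, HasHilbCoeffs R I B s eB → HasHilbCoeffs R I C s eC →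
        (∀ i < s - t, eB i = eC i) ∧ (t = 0 → 2 ≤ s → eB 1 = eC 1)) ∧
    -- (c)
    (∀ (M : Type) [AddCommGroup M] [Module R M] [Module.Finite R M],
      mDim R M = (1 : ℕ∞) → IsParamIdeal R I M 1 →
      ∀ e : ℕ → ℤ, HasHilbCoeffs R I M 1 e →
        ∃ l : ℕ, mLength R ↥(LC R 0 M) = (l : ℕ∞) ∧ e 1 = -(l : ℤ)) ∧
    -- (d)
    (∀ (M : Type) [AddCommGroup M] [Module R M] [Module.Finite R M],
      mDim R M = (2 : ℕ∞) → IsParamIdeal R I M 2 →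
      ∀ h : R, IsSuperficial R I M h →
      ∀ e e' : ℕ → ℤ, HasHilbCoeffs R I M 2 e →
        HasHilbCoeffs R I (M ⧸ Ideal.span {h} • (⊤ : Submodule R M)) 1 e' →
      ∃ a b c : ℕ,
        mLength R ↥(LinearMap.ker (LinearMap.lsmul R M h)) = (a : ℕ∞) ∧
        mLength R ↥(LC R 0 (M ⧸ Ideal.span {h} • (⊤ : Submodule R M))) = (b : ℕ∞) ∧
        mLength R ↥(LinearMap.ker (LinearMap.lsmul R ↥(LC R 1 M) h)) = (c : ℕ∞) ∧
        e 1 = e' 1 + (a : ℤ) ∧ e 1 = -(b : ℤ) + (a : ℤ) ∧ e 1 = -(c : ℤ)) := by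
  refine ⟨?_, ?_, ?_, ?_⟩
  · intro M _ _ _ r _ hr h hs e e' he he' a ha
    obtain ⟨r, rfl⟩ := Nat.exists_eq_succ_of_ne_zero hr.ne'
    obtain ⟨a', ha', h1, h2⟩ := coeff_superficial hI hs he he'
    rw [mLength_eq_iff, ha'] at ha
    obtain rfl : a' = a := by exact_mod_cast ha
    exact ⟨h1, h2⟩
  · intro A B C _ _ _ _ _ _ _ _ _ f g hf hg hfg t s hA _ hts eB eC hB hC
    have h1 := coeff_eq_of_exact hI f g hg hfg hA hB hC
    exact ⟨h1, fun _ _ => h1 1 (by omega)⟩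
  · rintro M _ _ _ _ ⟨-, ⟨x, rfl⟩, -⟩ e he
    obtain ⟨w, hw, he1⟩ := coeff_one_eq_neg_length hI he (Ideal.subset_span ⟨0, rfl⟩) (by
      intro a ha
      rw [Ideal.mem_span_range_iff_exists_fun] at ha
      obtain ⟨c, rfl⟩ := ha
      exact ⟨c 0, fun z => by simp⟩)
    exact ⟨w, (mLength_LC_zero M w).2 hw, he1⟩
  · rintro M _ _ _ hM ⟨-, ⟨x, hx⟩, -⟩ h hs e e' he he'
    obtain ⟨a, ha, -, h1⟩ := coeff_superficial hI hs he he'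
    obtain ⟨y, hy, hIy⟩ := exists_complement hx hs.1
      (notMem_maximalIdeal_mul_of_superficial hI hs (by rw [hM]; norm_cast))
    obtain ⟨b, hb, h2⟩ := coeff_one_eq_neg_length hI he' hy (by
      intro r hr
      obtain ⟨c, b, rfl⟩ := hIy r hr
      refine ⟨b, fun z => ?_⟩
      obtain ⟨z, rfl⟩ := Submodule.mkQ_surjective _ z
      rw [add_smul, add_eq_right, ← map_smul]
      refine (Submodule.Quotient.mk_eq_zero _).2 ((mem_span_singleton_smul_top _ _).2 ⟨c • z, ?_⟩)
      rw [smul_smul, mul_comm])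
    obtain ⟨k, hk⟩ := exists_superficial_injective hI hs
    obtain ⟨q, -, hq⟩ := exists_pow_maximalIdeal_le hI
    have h3 := length_powTorsion_quotient hk (q := q * k) (by
      rw [pow_mul]
      exact Submodule.smul_mono_left (Ideal.pow_right_mono hq k))
    have hc : Module.length R (LinearMap.ker (LinearMap.lsmul R (LC R 1 M) h)) ≠ ⊤ := by
      intro hc
      rw [hb, hc, add_top] at h3
      exact ENat.natCast_ne_top _ h3
    obtain ⟨c, hc⟩ := ENat.ne_top_iff_exists.1 hc
    rw [ha, hb, ← hc] at h3
    have h3 : b = a + c := by exact_mod_cast h3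
    refine ⟨a, b, c, (mLength_eq_iff a).2 ha, (mLength_LC_zero _ b).2 hb,
      (mLength_eq_iff c).2 hc.symm, ?_, ?_, ?_⟩ <;> rw [h1]
    · ring
    · rw [h2]
      ring
    · rw [h2, h3]
      push_cast
      ring
end

section
/- Let (R,m) be a Noetherian local ring and M a finitely generated R-module of positive dimension. If I is a parameter ideal for M, then the first Hilbert coefficient satisfies e_1(I,M) ≤ 0. -/
open IsLocalRing

open Filter Topology in
lemma tendsto_choose_add_div_pow (c d m : ℕ) (h : d ≤ m) :
    Tendsto (fun j : ℕ => ((j + c).choose d : ℝ) / (j : ℝ) ^ m) atTop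
      (𝓝 (if d = m then ((d.factorial : ℝ))⁻¹ else 0)) := by
  have h1 : Tendsto (fun j : ℕ => ((j + c).choose d : ℝ) / ((j + c : ℕ) : ℝ) ^ d) atTop
      (𝓝 ((d.factorial : ℝ))⁻¹) := by
    have hf : (d.factorial : ℝ) ≠ 0 := mod_cast d.factorial_ne_zero
    have hz : ∀ᶠ n : ℕ in atTop, (n : ℝ) ^ d / d.factorial ≠ 0 := by
      filter_upwards [eventually_gt_atTop 0] with n hn
      positivity
    have := ((Asymptotics.isEquivalent_iff_tendsto_one hz).1 (isEquivalent_choose d)).mul_const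
      ((d.factorial : ℝ))⁻¹
    rw [one_mul] at this
    refine Tendsto.comp (g := fun n : ℕ => (n.choose d : ℝ) / (n : ℝ) ^ d) (this.congr' ?_)
      (tendsto_add_atTop_nat c)
    filter_upwards [eventually_gt_atTop 0] with n hn
    simp only [Pi.div_apply]
    field_simp
  have h2 : Tendsto (fun j : ℕ => (((j + c : ℕ) : ℝ) / j) ^ d) atTop (𝓝 1) := by
    have : Tendsto (fun j : ℕ => ((j + c : ℕ) : ℝ) / j) atTop (𝓝 1) := by
      have h3 := (tendsto_const_div_atTop_nhds_zero_nat (c : ℝ)).const_add 1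
      rw [add_zero] at h3
      refine h3.congr' ?_
      filter_upwards [eventually_gt_atTop 0] with n hn
      push_cast
      field_simp
    simpa using this.pow d
  have h3 : Tendsto (fun j : ℕ => (((j : ℝ)) ^ (m - d))⁻¹) atTop
      (𝓝 (if d = m then 1 else 0)) := by
    split_ifs with hd
    · simp [hd]
    · exact ((tendsto_pow_atTop (by lia)).comp tendsto_natCast_atTop_atTop).inv_tendsto_atTop
  have := (h1.mul h2).mul h3
  simp only [mul_one, mul_ite, mul_zero] at this
  refine this.congr' ?_
  filter_upwards [eventually_gt_atTop 0] with n hn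
  obtain ⟨e, rfl⟩ := Nat.exists_eq_add_of_le h
  have : (n : ℝ) + c ≠ 0 := by positivity
  push_cast
  rw [Nat.add_sub_cancel_left, pow_add, div_pow]
  field_simp

open Filter Topology in
lemma tendsto_sum_choose_div_pow (r : ℕ) (s : ℕ → ℤ) (m : ℕ) (hm : m ≤ r) :
    Tendsto (fun n : ℕ => (∑ i ∈ Finset.Icc m r,
        (-1 : ℝ) ^ i * s i * ((n + r - i).choose (r - i) : ℝ)) / (n : ℝ) ^ (r - m)) atTop
      (𝓝 ((-1) ^ m * s m * (((r - m).factorial : ℝ))⁻¹)) := by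
  have h : Tendsto (fun n : ℕ => ∑ i ∈ Finset.Icc m r,
        (-1 : ℝ) ^ i * s i * (((n + (r - i)).choose (r - i) : ℝ) / (n : ℝ) ^ (r - m))) atTop
      (𝓝 (∑ i ∈ Finset.Icc m r, (-1 : ℝ) ^ i * s i *
        if r - i = r - m then (((r - i).factorial : ℝ))⁻¹ else 0)) := by
    refine tendsto_finsetSum _ fun i hi => (tendsto_choose_add_div_pow _ _ _ ?_).const_mul _
    have := Finset.mem_Icc.1 hi
    lia
  convert h using 2
  · rw [Finset.sum_div]
    refine Finset.sum_congr rfl fun i hi => ?_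
    rw [Nat.add_sub_assoc (Finset.mem_Icc.1 hi).2, mul_div_assoc]
  · rw [Finset.sum_eq_single_of_mem m (by simp [hm])]
    · simp
    · intro i hi him
      have := Finset.mem_Icc.1 hi
      rw [if_neg (by lia), mul_zero]

open Filter Topology in
lemma coeff_one_nonpos_of_choose_mul_le {r : ℕ} (hr : 0 < r) (s : ℕ → ℤ) (l : ℕ → ℕ) (N : ℕ)
    (hl : ∀ n ≥ N, (l n : ℤ) = ∑ i ∈ Finset.range (r + 1),
      (-1 : ℤ) ^ i * s i * ((n + r - i).choose (r - i) : ℤ))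
    (h : ∀ n ≥ N, ∀ j ≥ N, (n + r).choose r * l j ≤ (j + (n + r)).choose r * l n) :
    s 1 ≤ 0 := by
  have hl' : ∀ n ≥ N, (l n : ℝ) = ∑ i ∈ Finset.Icc 0 r,
      (-1 : ℝ) ^ i * s i * ((n + r - i).choose (r - i) : ℝ) := by
    intro n hn
    have : Finset.Icc 0 r = Finset.range (r + 1) := by ext; simp
    rw [this]
    exact_mod_cast congrArg (Int.cast (R := ℝ)) (hl n hn)
  have hlead : ∀ n ≥ N, (s 0 : ℝ) * (n + r).choose r ≤ l n := by
    intro n hn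
    have t1 := ((tendsto_sum_choose_div_pow r s 0 (Nat.zero_le r)).const_mul
      ((n + r).choose r : ℝ))
    have t2 := (tendsto_choose_add_div_pow (n + r) r r le_rfl).mul_const (l n : ℝ)
    have key := le_of_tendsto_of_tendsto t1 t2 (by
      filter_upwards [eventually_ge_atTop N] with j hj
      rw [← hl' j hj, Nat.sub_zero, ← mul_div_assoc, div_mul_eq_mul_div]
      exact div_le_div_of_nonneg_right (mod_cast h n hn j hj) (by positivity))
    have hf : (0 : ℝ) < r.factorial := mod_cast r.factorial_pos
    simp only [pow_zero, one_mul, Nat.sub_zero, if_true] at key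
    field_simp at key
    linarith
  have hnn : 0 ≤ (-1 : ℝ) ^ 1 * s 1 * (((r - 1).factorial : ℝ))⁻¹ := by
    refine ge_of_tendsto (tendsto_sum_choose_div_pow r s 1 hr) ?_
    filter_upwards [eventually_ge_atTop N] with n hn
    refine div_nonneg ?_ (by positivity)
    have := hlead n hn
    rw [hl' n hn, ← Finset.add_sum_Ioc_eq_sum_Icc (Nat.zero_le r)] at this
    have h0 : Finset.Ioc 0 r = Finset.Icc 1 r := by ext; simp [Nat.succ_le_iff]
    rw [h0] at this
    simpa using this
  have hf : (0 : ℝ) < (r - 1).factorial := mod_cast (r - 1).factorial_pos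
  have : (s 1 : ℝ) ≤ 0 := by
    by_contra! hc
    have : 0 < (s 1 : ℝ) * (((r - 1).factorial : ℝ))⁻¹ := by positivity
    linarith
  exact_mod_cast this

section HilbertFunction

open Module

lemma length_le_of_ker_le {R N A A' : Type*} [Ring R] [AddCommGroup N] [AddCommGroup A]
    [AddCommGroup A'] [Module R N] [Module R A] [Module R A'] (f : N →ₗ[R] A) (g : N →ₗ[R] A')
    (hf : Function.Surjective f) (hg : Function.Surjective g)
    (h : LinearMap.ker f ≤ LinearMap.ker g) : length R A' ≤ length R A := by
  rw [← (f.quotKerEquivOfSurjective hf).length_eq]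
  exact length_le_of_surjective ((LinearMap.ker f).liftQ g h)
    (by rw [← LinearMap.range_eq_top, Submodule.range_liftQ, LinearMap.range_eq_top.2 hg])

lemma sum_range_multichoose (r n : ℕ) :
    ∑ j ∈ Finset.range (n + 1), r.multichoose j = (r + 1).multichoose n := by
  induction n with
  | zero => simp
  | succ n ih => rw [Finset.sum_range_succ, ih, Nat.multichoose_succ_succ, add_comm]

lemma span_range_pow_eq_span_image {B ι : Type*} [Fintype ι] [DecidableEq ι] [CommRing B]
    (z : ι → B) (n : ℕ) :
    Ideal.span (Set.range z) ^ n = Ideal.span ((fun α : ι →₀ ℕ => α.prod fun i k => z i ^ k) ''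
      (Finset.univ.finsuppAntidiag n : Finset (ι →₀ ℕ))) := by
  have h := congrArg (Ideal.map (MvPolynomial.aeval (R := B) z))
    (MvPolynomial.pow_idealOfVars_eq_span (σ := ι) (R := B) n)
  rw [Ideal.map_pow, MvPolynomial.idealOfVars, Ideal.map_span, Ideal.map_span, ← Set.range_comp,
    Set.image_image] at h
  convert h using 2
  · congr 2
    ext i
    simp
  · congr 1
    · ext α
      simp [MvPolynomial.aeval_monomial]
    · ext α
      simp [Finsupp.degree_eq_sum]

lemma length_le_add_of_exact {R A N C : Type*} [Ring R] [AddCommGroup A] [AddCommGroup N]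
    [AddCommGroup C] [Module R A] [Module R N] [Module R C] (f : A →ₗ[R] N) (g : N →ₗ[R] C)
    (hg : Function.Surjective g) (h : Function.Exact f g) :
    length R N ≤ length R A + length R C := by
  rw [length_eq_add_of_exact (LinearMap.ker g).subtype g (Submodule.subtype_injective _) hg
    (LinearMap.exact_subtype_ker_map g), LinearMap.exact_iff.1 h]
  exact add_le_add_left (length_le_of_surjective f.rangeRestrict f.surjective_rangeRestrict) _

lemma length_quotient_pow_smul_le {R B P : Type*} [CommRing R] [CommRing B] [Algebra R B]
    [AddCommGroup P] [Module R P] [Module B P] [IsScalarTower R B P] {r : ℕ} (z : Fin r → B)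
    (n : ℕ) :
    length R (P ⧸ (Ideal.span (Set.range z) ^ (n + 1) • (⊤ : Submodule B P))) ≤
      ((r + 1).multichoose n : ℕ∞) *
        length R (P ⧸ (Ideal.span (Set.range z) • (⊤ : Submodule B P))) := by
  set q := Ideal.span (Set.range z) with hq
  rw [← sum_range_multichoose]
  induction n with
  | zero => rw [zero_add, pow_one]; simp
  | succ n ih =>
    rw [Finset.sum_range_succ, Nat.cast_add, add_mul]
    refine le_trans ?_ (add_le_add_left ih _)
    classical
    let S : Finset (Fin r →₀ ℕ) := Finset.univ.finsuppAntidiag (n + 1)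
    let w : (Fin r →₀ ℕ) → B := fun α => α.prod fun i k => z i ^ k
    have hspan : q ^ (n + 1) = Ideal.span (w '' S) := span_range_pow_eq_span_image z (n + 1)
    have hw : ∀ α ∈ S, w α ∈ q ^ (n + 1) := fun α hα => by
      rw [hspan]
      exact Ideal.subset_span ⟨α, hα, rfl⟩
    have hle : q ^ (n + 1 + 1) • (⊤ : Submodule B P) ≤ q ^ (n + 1) • ⊤ :=
      Submodule.smul_mono_left (Ideal.pow_le_pow_right (Nat.le_succ _))
    let m : S → (P ⧸ q • (⊤ : Submodule B P)) →ₗ[B]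
        (P ⧸ q ^ (n + 1 + 1) • (⊤ : Submodule B P)) :=
      fun α => Submodule.mapQ _ _ (LinearMap.lsmul B P (w α)) (by
        rw [← Submodule.map_le_iff_le_comap, pow_succ, Submodule.mul_smul]
        rintro _ ⟨p, hp, rfl⟩
        exact Submodule.smul_mem_smul (hw α α.2) hp)
    let f : (S → P ⧸ q • (⊤ : Submodule B P)) →ₗ[B]
        (P ⧸ q ^ (n + 1 + 1) • (⊤ : Submodule B P)) :=
      ∑ α, (m α).comp (LinearMap.proj α)
    have hf : ∀ (α : S) (p : P), f (Pi.single α (Submodule.Quotient.mk p)) =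
        Submodule.Quotient.mk (w α • p) := fun α p => by
      simp only [f, LinearMap.sum_apply, LinearMap.comp_apply, LinearMap.proj_apply]
      rw [Finset.sum_eq_single_of_mem α (Finset.mem_univ _) fun β _ hβ => by
        rw [Pi.single_eq_of_ne hβ, map_zero], Pi.single_eq_same]
      rfl
    have hexact : Function.Exact (f.restrictScalars R)
        ((Submodule.factor hle).restrictScalars R) := by
      intro y
      obtain ⟨p, rfl⟩ := Submodule.Quotient.mk_surjective _ y
      rw [show ((Submodule.factor hle).restrictScalars R) (Submodule.Quotient.mk p) =
        Submodule.Quotient.mk p from rfl, Submodule.Quotient.mk_eq_zero]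
      constructor
      · have : q ^ (n + 1) • ⊤ ≤
            (LinearMap.range f).comap (q ^ (n + 1 + 1) • (⊤ : Submodule B P)).mkQ := by
          rw [hspan]
          refine Submodule.smul_le.2 fun b hb p _ => ?_
          induction hb using Submodule.span_induction with
          | mem b hb =>
            obtain ⟨α, hα, rfl⟩ := hb
            exact ⟨_, hf ⟨α, hα⟩ p⟩
          | zero => simp
          | add b c _ _ hb hc => rw [add_smul]; exact add_mem hb hc
          | smul c b _ hb => rw [smul_assoc]; exact Submodule.smul_mem _ _ hb
        exact fun hp => this hp
      · rintro ⟨x, hx⟩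
        have hx' : ∀ x, Submodule.factor hle (f x) = 0 := fun x => by
          simp only [f, LinearMap.sum_apply, LinearMap.comp_apply, LinearMap.proj_apply, map_sum]
          refine Finset.sum_eq_zero fun α _ => ?_
          obtain ⟨p, hp⟩ := Submodule.Quotient.mk_surjective _ (x α)
          rw [← hp]
          exact (Submodule.Quotient.mk_eq_zero _).2
            (Submodule.smul_mem_smul (hw α α.2) Submodule.mem_top)
        have := hx' x
        rw [show f x = _ from hx] at this
        exact (Submodule.Quotient.mk_eq_zero _).1 this
    refine (length_le_add_of_exact (f.restrictScalars R)
      ((Submodule.factor hle).restrictScalars R)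
      (Submodule.factor_surjective hle) hexact).trans_eq ?_
    rw [add_comm]
    congr 1
    simp [S, Finset.card_finsuppAntidiag_nat_eq_multichoose]


section

variable {R : Type*} [CommRing R] {r : ℕ} (x : Fin r → R)

open MvPolynomial

lemma sub_C_eval_mem_span (b : MvPolynomial (Fin r) R) :
    b - C (eval x b) ∈ Ideal.span (Set.range fun i => X i - C (x i)) := by
  rw [← Ideal.Quotient.eq]
  have : (Ideal.Quotient.mk (Ideal.span (Set.range fun i => X i - C (x i)))) =
      ((Ideal.Quotient.mk (Ideal.span (Set.range fun i => X i - C (x i)))).comp C).comp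
        (eval x) := by
    refine MvPolynomial.ringHom_ext (by simp) fun i => ?_
    simp only [RingHom.comp_apply, eval_X]
    exact Ideal.Quotient.eq.2 (Ideal.subset_span ⟨i, rfl⟩)
  exact congrArg (fun φ => φ b) this

/-- Polynomials whose coefficients of degree `d` lie in `I ^ (k - d)`. -/
def coeffPowIdeal (σ : Type*) (I : Ideal R) (k : ℕ) : Ideal (MvPolynomial σ R) where
  carrier := {b | ∀ α, b.coeff α ∈ I ^ (k - α.degree)}
  zero_mem' α := by simp
  add_mem' ha hb α := by simpa using add_mem (ha α) (hb α)
  smul_mem' c b hb α := by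
    classical
    rw [smul_eq_mul, coeff_mul]
    refine sum_mem fun p hp => Ideal.mul_mem_left _ _ (Ideal.pow_le_pow_right ?_ (hb p.2))
    rw [← Finset.HasAntidiagonal.mem_antidiagonal.1 hp, map_add]
    lia

lemma span_X_sub_C_pow_le (k : ℕ) :
    Ideal.span (Set.range fun i => X i - C (x i)) ^ k ≤
      coeffPowIdeal (Fin r) (Ideal.span (Set.range x)) k := by
  classical
  induction k with
  | zero => intro b _ α; simp
  | succ k ih =>
    rw [pow_succ, Ideal.mul_le]
    intro b hb c hc
    induction hc using Submodule.span_induction with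
    | mem c hc =>
      obtain ⟨i, rfl⟩ := hc
      intro α
      rw [mul_sub, coeff_sub, coeff_mul_X', mul_comm, coeff_C_mul, mul_comm]
      refine sub_mem ?_ ?_
      · split_ifs with hi
        · refine Ideal.pow_le_pow_right ?_ (ih hb _)
          have h1 : Finsupp.single i 1 ≤ α := by
            rw [Finsupp.single_le_iff]
            exact Nat.one_le_iff_ne_zero.2 (Finsupp.mem_support_iff.1 hi)
          have h2 := congrArg Finsupp.degree (tsub_add_cancel_of_le h1)
          rw [map_add, Finsupp.degree_single] at h2
          lia
        · exact zero_mem _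
      · refine Ideal.pow_le_pow_right (show _ ≤ (k - α.degree) + 1 by lia) ?_
        rw [pow_succ]
        exact Ideal.mul_mem_mul (ih hb α) (Ideal.subset_span ⟨i, rfl⟩)
    | zero => simp
    | add c d _ _ hc hd => rw [mul_add]; exact add_mem hc hd
    | smul e c _ hc => rw [smul_eq_mul, mul_left_comm]; exact Ideal.mul_mem_left _ _ hc

open TensorProduct

variable (M : Type*) [AddCommGroup M] [Module R M]

/-- The truncated polynomial module `M[Y₁, …, Yᵣ] / (Y₁, …, Yᵣ) ^ n`. -/
abbrev TruncPoly (R : Type*) [CommRing R] (r : ℕ) (M : Type*) [AddCommGroup M] [Module R M]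
    (n : ℕ) :=
  (MvPolynomial (Fin r) R ⊗[R] M) ⧸ (idealOfVars (Fin r) R ^ n •
    (⊤ : Submodule (MvPolynomial (Fin r) R) (MvPolynomial (Fin r) R ⊗[R] M)))

lemma length_truncPoly_quotient_le (n : ℕ) :
    length R (TruncPoly R r M n ⧸ (Ideal.span (Set.range fun i => X i - C (x i)) •
      (⊤ : Submodule (MvPolynomial (Fin r) R) (TruncPoly R r M n)))) ≤
    length R (M ⧸ (Ideal.span (Set.range x) ^ n • (⊤ : Submodule R M))) := by
  set q : Ideal (MvPolynomial (Fin r) R) := Ideal.span (Set.range fun i => X i - C (x i))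
  let π : TruncPoly R r M n →ₗ[MvPolynomial (Fin r) R] _ :=
    (q • (⊤ : Submodule (MvPolynomial (Fin r) R) (TruncPoly R r M n))).mkQ
  let ρ : (MvPolynomial (Fin r) R ⊗[R] M) →ₗ[MvPolynomial (Fin r) R] TruncPoly R r M n :=
    (idealOfVars (Fin r) R ^ n •
      (⊤ : Submodule (MvPolynomial (Fin r) R) (MvPolynomial (Fin r) R ⊗[R] M))).mkQ
  let τ : (MvPolynomial (Fin r) R ⊗[R] M) →ₗ[MvPolynomial (Fin r) R] _ := π ∘ₗ ρ
  have hτs : Function.Surjective τ :=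
    (Submodule.mkQ_surjective _).comp (Submodule.mkQ_surjective _)
  have hτY : ∀ b ∈ idealOfVars (Fin r) R ^ n, ∀ u, τ (b • u) = 0 := fun b hb u => by
    have : ρ (b • u) = 0 :=
      (Submodule.Quotient.mk_eq_zero _).2 (Submodule.smul_mem_smul hb Submodule.mem_top)
    rw [LinearMap.comp_apply, this, map_zero]
  have hτq : ∀ b ∈ q, ∀ u, τ (b • u) = 0 := fun b hb u => by
    rw [LinearMap.comp_apply, map_smul]
    exact (Submodule.Quotient.mk_eq_zero _).2 (Submodule.smul_mem_smul hb Submodule.mem_top)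
  have hτe : ∀ (b : MvPolynomial (Fin r) R) u, τ (b • u) = τ (eval x b • u) := fun b u => by
    have h : b • u = (b - C (eval x b)) • u + (C (eval x b) : MvPolynomial (Fin r) R) • u := by
      rw [← add_smul, sub_add_cancel]
    rw [h, map_add, hτq _ (sub_C_eval_mem_span x b), zero_add, ← algebraMap_eq, algebraMap_smul]
  refine length_le_of_ker_le (Submodule.mkQ _)
    ((τ.restrictScalars R).comp (TensorProduct.mk R (MvPolynomial (Fin r) R) M 1))
    (Submodule.mkQ_surjective _) ?_ ?_
  · intro y
    obtain ⟨u, rfl⟩ := hτs y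
    induction u with
    | zero => exact ⟨0, by simp⟩
    | add u v hu hv =>
      obtain ⟨a, ha⟩ := hu
      obtain ⟨b, hb⟩ := hv
      exact ⟨a + b, by rw [map_add, ha, hb, map_add]⟩
    | tmul b m =>
      refine ⟨eval x b • m, ?_⟩
      have := hτe b (1 ⊗ₜ m)
      rw [smul_tmul', smul_eq_mul, mul_one] at this
      rw [this]
      simp
  · rw [Submodule.ker_mkQ]
    refine Submodule.smul_le.2 fun a ha m _ => ?_
    have hmap : Ideal.span (Set.range x) ^ n = Ideal.map (eval x) (idealOfVars (Fin r) R ^ n) := by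
      rw [Ideal.map_pow, idealOfVars, Ideal.map_span, ← Set.range_comp]
      congr 3
      ext i
      simp
    rw [hmap] at ha
    obtain ⟨b, hb, rfl⟩ := (Ideal.mem_map_iff_of_surjective (eval x)
      (fun a => ⟨C a, eval_C a⟩)).1 ha
    have := hτe b (1 ⊗ₜ m)
    rw [hτY b hb] at this
    simpa using this.symm

lemma card_degree_le (n : ℕ) :
    Nat.card {α : Fin r →₀ ℕ // α.degree ≤ n} = (r + 1).multichoose n := by
  classical
  have h : {α : Fin r →₀ ℕ | α.degree ≤ n} =
      ((Finset.range (n + 1)).biUnion fun j => Finset.univ.finsuppAntidiag j :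
        Finset (Fin r →₀ ℕ)) := by
    ext α
    simp [Finsupp.degree_eq_sum]
  rw [← Set.coe_ofPred, h, Nat.card_coe_set_eq, Set.ncard_coe_finset, Finset.card_biUnion,
    ← sum_range_multichoose]
  · simp [Finset.card_finsuppAntidiag_nat_eq_multichoose]
  · intro i _ j _ hij
    refine Finset.disjoint_left.2 fun α hi hj => hij ?_
    rw [← (Finset.mem_finsuppAntidiag.1 hi).1, ← (Finset.mem_finsuppAntidiag.1 hj).1]

lemma multichoose_mul_length_le (n j : ℕ) :
    ((r + 1).multichoose n : ℕ∞) *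
      length R (M ⧸ (Ideal.span (Set.range x) ^ j • (⊤ : Submodule R M))) ≤
    length R (TruncPoly R r M (n + 1) ⧸ (Ideal.span (Set.range fun i => X i - C (x i)) ^ (n + j) •
      (⊤ : Submodule (MvPolynomial (Fin r) R) (TruncPoly R r M (n + 1))))) := by
  set q : Ideal (MvPolynomial (Fin r) R) := Ideal.span (Set.range fun i => X i - C (x i))
  set Q := Ideal.span (Set.range x)
  let π := (q ^ (n + j) • (⊤ : Submodule (MvPolynomial (Fin r) R) (TruncPoly R r M (n + 1)))).mkQ
  let ρ := (idealOfVars (Fin r) R ^ (n + 1) •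
    (⊤ : Submodule (MvPolynomial (Fin r) R) (MvPolynomial (Fin r) R ⊗[R] M))).mkQ
  let ι := {α : Fin r →₀ ℕ // α.degree ≤ n}
  have hfin : Finite ι := Nat.finite_of_card_ne_zero (by
    rw [card_degree_le, Nat.multichoose_eq]
    exact (Nat.choose_pos (by lia)).ne')
  let g : (MvPolynomial (Fin r) R ⊗[R] M) →ₗ[R] (ι → M ⧸ (Q ^ j • (⊤ : Submodule R M))) :=
    LinearMap.pi fun α => TensorProduct.lift
      ((LinearMap.compr₂ (LinearMap.lsmul R M) (Submodule.mkQ _)).comp (lcoeff R α.1))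
  have hg : ∀ b m α, g (b ⊗ₜ m) α = Submodule.Quotient.mk (coeff α.1 b • m) := fun _ _ _ => rfl
  have hcard : ((r + 1).multichoose n : ℕ∞) = ENat.card ι := by
    rw [← card_degree_le, ENat.card_eq_coe_natCard]
  rw [hcard, ← length_pi]
  refine length_le_of_ker_le ((π ∘ₗ ρ).restrictScalars R) g
    ((Submodule.mkQ_surjective _).comp (Submodule.mkQ_surjective _)) ?_ ?_
  · classical
    cases nonempty_fintype ι
    intro y
    choose m hm using fun α => Submodule.Quotient.mk_surjective _ (y α)
    refine ⟨∑ α, monomial α.1 (1 : R) ⊗ₜ m α, funext fun β => ?_⟩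
    rw [map_sum, Finset.sum_apply, Finset.sum_eq_single_of_mem β (Finset.mem_univ _)]
    · rw [hg, coeff_monomial, if_pos rfl, one_smul, hm]
    · intro α _ hα
      rw [hg, coeff_monomial, if_neg fun h => hα (Subtype.ext h), zero_smul]
      rfl
  · have hT : ∀ b : MvPolynomial (Fin r) R, (∀ α, α.degree ≤ n → coeff α b ∈ Q ^ j) →
        ∀ u, b • u ∈ LinearMap.ker g := by
      intro b hb u
      rw [LinearMap.mem_ker]
      induction u with
      | zero => simp
      | add u v hu hv => rw [smul_add, map_add, hu, hv, add_zero]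
      | tmul c m =>
        funext α
        rw [smul_tmul', smul_eq_mul, hg, Pi.zero_apply, Submodule.Quotient.mk_eq_zero]
        refine Submodule.smul_mem_smul ?_ Submodule.mem_top
        classical
        rw [coeff_mul]
        refine sum_mem fun p hp => Ideal.mul_mem_right _ _ (hb _ ?_)
        have := congrArg Finsupp.degree (Finset.HasAntidiagonal.mem_antidiagonal.1 hp)
        rw [map_add] at this
        have := α.2
        lia
    intro u hu
    have h1 : ρ u ∈ q ^ (n + j) •
        (⊤ : Submodule (MvPolynomial (Fin r) R) (TruncPoly R r M (n + 1))) :=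
      (Submodule.Quotient.mk_eq_zero _).1 hu
    have htop : (⊤ : Submodule (MvPolynomial (Fin r) R) (TruncPoly R r M (n + 1))) =
        Submodule.map ρ ⊤ := by
      rw [Submodule.map_top, Submodule.range_mkQ]
    rw [htop, ← Submodule.map_smul''] at h1
    obtain ⟨v, hv, hvu⟩ := h1
    have h2 : u - v ∈ idealOfVars (Fin r) R ^ (n + 1) •
        (⊤ : Submodule (MvPolynomial (Fin r) R) (MvPolynomial (Fin r) R ⊗[R] M)) :=
      (Submodule.Quotient.eq _).1 hvu.symm
    have hv' : v ∈ LinearMap.ker g := by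
      refine Submodule.smul_induction_on hv (fun b hb u _ => hT b (fun α hα => ?_) u)
        fun _ _ => add_mem
      exact Ideal.pow_le_pow_right (by lia) (span_X_sub_C_pow_le x _ hb α)
    have huv : u - v ∈ LinearMap.ker g := by
      refine Submodule.smul_induction_on h2 (fun b hb u _ => hT b (fun α hα => ?_) u)
        fun _ _ => add_mem
      rw [(mem_pow_idealOfVars_iff' _ _).1 hb α (by lia)]
      exact zero_mem _
    simpa using add_mem huv hv'

end

/-- For `Q` generated by `r` elements, comparing the `Q`-adic filtration on the truncated polynomial
module with the one by powers of `(Yᵢ - xᵢ)` gives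
`C(n + r, r) λ(M/Q^{j+1}M) ≤ C(n + j + r, r) λ(M/Q^{n+1}M)`. -/
lemma multichoose_mul_length_quotient_pow_le {R M : Type*} [CommRing R] [AddCommGroup M]
    [Module R M] {r : ℕ} (x : Fin r → R) (n j : ℕ) :
    ((r + 1).multichoose n : ℕ∞) *
      length R (M ⧸ (Ideal.span (Set.range x) ^ (j + 1) • (⊤ : Submodule R M))) ≤
    ((r + 1).multichoose (n + j) : ℕ∞) *
      length R (M ⧸ (Ideal.span (Set.range x) ^ (n + 1) • (⊤ : Submodule R M))) :=
  (multichoose_mul_length_le x M n (j + 1)).trans <|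
    (length_quotient_pow_smul_le _ (n + j)).trans <|
      mul_le_mul_right (length_truncPoly_quotient_le x M (n + 1)) _

end HilbertFunction

theorem statement2 (R : Type) [CommRing R] [IsLocalRing R] [IsNoetherianRing R]
    (M : Type) [AddCommGroup M] [Module R M] [Module.Finite R M]
    (r : ℕ) (hr : mDim R M = (r : ℕ∞)) (hr0 : 0 < r)
    (I : Ideal R) (hQ : IsParamIdeal R I M r)
    (e : ℕ → ℤ) (he : HasHilbCoeffs R I M r e) :
    e 1 ≤ 0 := by
  obtain ⟨-, ⟨x, rfl⟩, -⟩ := hQ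
  obtain ⟨N, hN⟩ := he
  choose! l hl hls using hN
  have hlen : ∀ n ≥ N, Module.length R
      (M ⧸ (Ideal.span (Set.range x) ^ (n + 1) • (⊤ : Submodule R M))) = l n := fun n hn =>
    WithBot.coe_injective ((Module.coe_length R _).trans (hl n hn))
  refine coeff_one_nonpos_of_choose_mul_le hr0 e l N hls fun n hn j hj => ?_
  have h := multichoose_mul_length_quotient_pow_le (M := M) x n j
  have hm : ∀ k, (r + 1).multichoose k = (k + r).choose r := fun k => by
    rw [Nat.multichoose_eq, show r + 1 + k - 1 = k + r by lia, Nat.choose_symm_add]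
  rw [hlen n hn, hlen j hj, hm, hm, add_right_comm, add_comm (n + r)] at h
  exact_mod_cast h
end
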